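/- arXiv:1610.07100 — 4 statements merged into one kernel-verified Lean document; each statement's English description precedes it below -/
import Mathlib

section
/- There exists a constant c > 0 such that for every integer f ≥ 1, every even integer l ≥ 2, and every N that is a positive multiple of l^f, there exists an Ising instance on N variables whose graph has maximum degree at most f·(l−1) and which has at least 2^{N·(1 − f·log₂(f·√l/c)/l)} global minima, every one of which is a (2^f − 1)-minimum. -/
open Finset

/-- An assignment gives each variable the value `-1` or `1`. -/
def IsAssignment {N : ℕ} (S : Fin N → ℝ) : Prop := ∀ i, S i = -1 ∨ S i = 1

/-- Energy of an Ising instance: `H(S) = ∑ i, h i * S i + ∑_{i<j} J i j * S i * S j`. -/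
noncomputable def energy {N : ℕ} (h : Fin N → ℝ) (J : Fin N → Fin N → ℝ)
    (S : Fin N → ℝ) : ℝ :=
  ∑ i, h i * S i + ∑ i, ∑ j, if i < j then J i j * S i * S j else 0

/-- The assignment obtained from `S` by flipping the spin at `i`. -/
noncomputable def flipAt {N : ℕ} (S : Fin N → ℝ) (i : Fin N) : Fin N → ℝ :=
  Function.update S i (-(S i))

/-- A local minimum: flipping any single variable strictly increases the energy. -/
def IsingLocalMin {N : ℕ} (h : Fin N → ℝ) (J : Fin N → Fin N → ℝ) (S : Fin N → ℝ) : Prop :=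
  IsAssignment S ∧ ∀ i, energy h J S < energy h J (flipAt S i)

/-- A global minimum: minimal energy among all assignments. -/
def IsingGlobalMin {N : ℕ} (h : Fin N → ℝ) (J : Fin N → Fin N → ℝ) (S : Fin N → ℝ) : Prop :=
  IsAssignment S ∧ ∀ S', IsAssignment S' → energy h J S ≤ energy h J S'

/-- Degree of variable `i` in the graph of the instance: the number of `j ≠ i` with `J i j ≠ 0`. -/
noncomputable def degreeJ {N : ℕ} (J : Fin N → Fin N → ℝ) (i : Fin N) : ℕ :=
  Set.ncard {j | j ≠ i ∧ J i j ≠ 0}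

/-- A `k`-minimum: every assignment differing from `S` in at least one and at most `k`
variables has strictly larger energy. -/
def IsingKMin {N : ℕ} (h : Fin N → ℝ) (J : Fin N → Fin N → ℝ) (k : ℕ) (S : Fin N → ℝ) : Prop :=
  IsAssignment S ∧ ∀ S', IsAssignment S' → S' ≠ S →
    Set.ncard {i | S i ≠ S' i} ≤ k → energy h J S < energy h J S'

lemma sum_ite_mem_univ {α : Type*} [Fintype α] [DecidableEq α] (s : Finset α) (g : α → ℝ) :
    ∑ i, (if i ∈ s then g i else 0) = ∑ i ∈ s, g i := by
  simp

lemma sum_sum_eq_diag_add_two_mul {N : ℕ} (g : Fin N → Fin N → ℝ)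
    (hg : ∀ i j, g i j = g j i) :
    ∑ i, ∑ j, g i j = ∑ i, g i i + 2 * ∑ i, ∑ j, if i < j then g i j else 0 := by
  have h1 : ∀ i j, g i j = (if i = j then g i j else 0) + (if i < j then g i j else 0)
      + (if j < i then g j i else 0) := by
    intro i j
    rcases lt_trichotomy i j with h | h | h
    · simp [h, h.ne, h.not_gt]
    · simp [h]
    · simp [h, h.ne', h.not_gt, hg i j]
  have h2 : ∑ i, ∑ j, (if j < i then g j i else 0) = ∑ i, ∑ j, if i < j then g i j else 0 :=
    Finset.sum_comm
  calc ∑ i, ∑ j, g i j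
      = ∑ i, ∑ j, ((if i = j then g i j else 0) + (if i < j then g i j else 0)
          + (if j < i then g j i else 0)) :=
        Finset.sum_congr rfl fun i _ => Finset.sum_congr rfl fun j _ => h1 i j
    _ = _ := by
        simp only [Finset.sum_add_distrib, h2, Finset.sum_ite_eq, Finset.mem_univ, if_true]
        ring

/-- The coupling that joins two distinct variables once for each block containing both. -/
noncomputable def blockCoupling {N : ℕ} {ι : Type*} [Fintype ι] (B : ι → Finset (Fin N))
    (i j : Fin N) : ℝ :=
  if i = j then 0 else ∑ b, if i ∈ B b ∧ j ∈ B b then 1 else 0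

/-- The field that makes block `b` prefer the spin sum `t b`. -/
noncomputable def blockField {N : ℕ} {ι : Type*} [Fintype ι] (B : ι → Finset (Fin N))
    (t : ι → ℝ) (i : Fin N) : ℝ :=
  -∑ b, if i ∈ B b then t b else 0

lemma blockCoupling_comm {N : ℕ} {ι : Type*} [Fintype ι] (B : ι → Finset (Fin N))
    (i j : Fin N) : blockCoupling B i j = blockCoupling B j i := by
  simp only [blockCoupling, eq_comm (a := i), and_comm (a := i ∈ _)]

lemma energy_block {N : ℕ} {ι : Type*} [Fintype ι] (B : ι → Finset (Fin N)) (t : ι → ℝ)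
    {S : Fin N → ℝ} (hS : IsAssignment S) :
    energy (blockField B t) (blockCoupling B) S
      = 1 / 2 * ∑ b, (∑ i ∈ B b, S i - t b) ^ 2 - 1 / 2 * ∑ b, (t b ^ 2 + (B b).card) := by
  have hsq : ∀ i, S i * S i = 1 := fun i => by rcases hS i with h | h <;> simp [h]
  have hfield : ∑ i, blockField B t i * S i = -∑ b, t b * ∑ i ∈ B b, S i := by
    simp only [blockField, neg_mul, Finset.sum_neg_distrib, Finset.sum_mul]
    rw [Finset.sum_comm]
    congr 1
    refine Finset.sum_congr rfl fun b _ => ?_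
    rw [← sum_ite_mem_univ (B b), Finset.mul_sum]
    exact Finset.sum_congr rfl fun i _ => by split_ifs <;> simp
  have hquad : ∀ b, (∑ i ∈ B b, S i) ^ 2 = (B b).card
      + 2 * ∑ i, ∑ j, if i < j then (if i ∈ B b ∧ j ∈ B b then S i * S j else 0) else 0 := by
    intro b
    rw [← sum_ite_mem_univ, sq, Finset.sum_mul_sum, sum_sum_eq_diag_add_two_mul _ fun i j => mul_comm _ _]
    congr 1
    · simp [← ite_and, hsq]
    · congr 1
      refine Finset.sum_congr rfl fun i _ => Finset.sum_congr rfl fun j _ => ?_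
      by_cases h1 : i ∈ B b <;> by_cases h2 : j ∈ B b <;> simp [h1, h2]
  have hcoup : ∑ i, ∑ j, (if i < j then blockCoupling B i j * S i * S j else 0)
      = ∑ b, ∑ i, ∑ j, if i < j then (if i ∈ B b ∧ j ∈ B b then S i * S j else 0) else 0 := by
    rw [Finset.sum_comm (s := (Finset.univ : Finset ι))]
    refine Finset.sum_congr rfl fun i _ => ?_
    rw [Finset.sum_comm (s := (Finset.univ : Finset ι))]
    refine Finset.sum_congr rfl fun j _ => ?_
    by_cases h : i < j
    · simp only [h, h.ne, blockCoupling, Finset.sum_mul, ite_mul, if_true, if_false, one_mul,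
        zero_mul]
    · simp [h]
  have hsum : ∑ b, (∑ i ∈ B b, S i - t b) ^ 2 = ∑ b, ((B b).card
      + 2 * (∑ i, ∑ j, if i < j then (if i ∈ B b ∧ j ∈ B b then S i * S j else 0) else 0)
      - 2 * (t b * ∑ i ∈ B b, S i) + t b ^ 2) :=
    Finset.sum_congr rfl fun b _ => by rw [← hquad]; ring
  rw [energy, hfield, hcoup, hsum]
  simp only [Finset.sum_add_distrib, Finset.sum_sub_distrib, ← Finset.mul_sum]
  ring

/-- Assignments whose block sums are prescribed. -/
def levelSet {N : ℕ} {ι : Type*} (B : ι → Finset (Fin N)) (t : ι → ℝ) : Set (Fin N → ℝ) :=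
  {S | IsAssignment S ∧ ∀ b, ∑ i ∈ B b, S i = t b}

lemma isingGlobalMin_iff_mem_levelSet {N : ℕ} {ι : Type*} [Fintype ι] (B : ι → Finset (Fin N))
    (t : ι → ℝ) (hne : (levelSet B t).Nonempty) (S : Fin N → ℝ) :
    IsingGlobalMin (blockField B t) (blockCoupling B) S ↔ S ∈ levelSet B t := by
  constructor
  · rintro ⟨hS, hmin⟩
    obtain ⟨S₀, hS₀, h₀⟩ := hne
    have h := hmin S₀ hS₀
    rw [energy_block B t hS, energy_block B t hS₀] at h
    simp only [h₀, sub_self, ne_eq, OfNat.ofNat_ne_zero, not_false_eq_true, zero_pow,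
      Finset.sum_const_zero, mul_zero] at h
    have hnn : ∀ b ∈ Finset.univ, 0 ≤ (∑ i ∈ B b, S i - t b) ^ 2 := fun b _ => sq_nonneg _
    have hz : ∑ b, (∑ i ∈ B b, S i - t b) ^ 2 = 0 :=
      le_antisymm (by linarith) (Finset.sum_nonneg hnn)
    refine ⟨hS, fun b => ?_⟩
    have := (Finset.sum_eq_zero_iff_of_nonneg hnn).1 hz b (Finset.mem_univ b)
    exact sub_eq_zero.1 (pow_eq_zero_iff two_ne_zero |>.1 this)
  · rintro ⟨hS, h⟩
    refine ⟨hS, fun S' hS' => ?_⟩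
    rw [energy_block B t hS, energy_block B t hS']
    simp only [h, sub_self, ne_eq, OfNat.ofNat_ne_zero, not_false_eq_true, zero_pow,
      Finset.sum_const_zero, mul_zero]
    have : 0 ≤ ∑ b, (∑ i ∈ B b, S' i - t b) ^ 2 := Finset.sum_nonneg fun b _ => sq_nonneg _
    linarith

lemma exists_ne_of_sum_eq {N : ℕ} {s : Finset (Fin N)} {S S' : Fin N → ℝ}
    (h : ∑ i ∈ s, S i = ∑ i ∈ s, S' i) {i : Fin N} (hi : i ∈ s) (hd : S i ≠ S' i) :
    ∃ j ∈ s, j ≠ i ∧ S j ≠ S' j := by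
  by_contra! hc
  have h0 : ∑ j ∈ s, (S j - S' j) = 0 := by rw [Finset.sum_sub_distrib, h, sub_self]
  rw [Finset.sum_eq_single_of_mem i hi fun j hj hji => sub_eq_zero.2 (hc j hj hji)] at h0
  exact hd (sub_eq_zero.1 h0)

/-- A nonempty set of points of a grid meeting no axis-parallel line in exactly one point has at
least `2 ^ f` elements. -/
lemma two_pow_le_card_of_no_isolated {α : Type*} [DecidableEq α] :
    ∀ (f : ℕ) (T : Finset (Fin f → α)), T.Nonempty →
      (∀ k, ∀ x ∈ T, ∃ y ∈ T, y ≠ x ∧ ∀ j, j ≠ k → y j = x j) → 2 ^ f ≤ T.card := by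
  intro f
  induction f with
  | zero => intro T hT _; simpa using hT.card_pos
  | succ f ih =>
    intro T ⟨x, hx⟩ hT
    have slice : ∀ z ∈ T, 2 ^ f ≤ (T.filter fun y => y 0 = z 0).card := by
      intro z hz
      have hinj : Set.InjOn (Fin.tail : (Fin (f + 1) → α) → Fin f → α)
          (T.filter fun y => y 0 = z 0) := by
        intro u hu v hv huv
        simp only [Finset.coe_filter, Set.mem_ofPred_eq] at hu hv
        rw [← Fin.cons_self_tail u, ← Fin.cons_self_tail v, huv, hu.2, hv.2]
      rw [← Finset.card_image_of_injOn hinj]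
      apply ih
      · exact ⟨Fin.tail z, Finset.mem_image_of_mem _ (Finset.mem_filter.2 ⟨hz, rfl⟩)⟩
      · intro k w hw
        obtain ⟨u, hu, rfl⟩ := Finset.mem_image.1 hw
        obtain ⟨huT, hu0⟩ := Finset.mem_filter.1 hu
        obtain ⟨v, hvT, hvu, hv⟩ := hT k.succ u huT
        have hv0 : v 0 = z 0 := (hv 0 (Fin.succ_ne_zero k).symm).trans hu0
        have hvm : v ∈ T.filter fun y => y 0 = z 0 := Finset.mem_filter.2 ⟨hvT, hv0⟩
        refine ⟨Fin.tail v, Finset.mem_image_of_mem _ hvm, fun h => hvu (hinj hvm hu h), ?_⟩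
        intro j hj
        exact hv j.succ fun h => hj (Fin.succ_injective _ h)
    obtain ⟨y, hy, hyx, hyj⟩ := hT 0 x hx
    have h0 : x 0 ≠ y 0 := by
      intro h
      apply hyx
      funext j
      by_cases hj : j = 0
      · rw [hj, h]
      · exact hyj j hj
    have hdisj : Disjoint (T.filter fun u => u 0 = x 0) (T.filter fun u => u 0 = y 0) :=
      Finset.disjoint_filter.2 fun u _ hu hu' => h0 (hu.symm.trans hu')
    calc 2 ^ (f + 1) = 2 ^ f + 2 ^ f := by ring
      _ ≤ _ := Nat.add_le_add (slice x hx) (slice y hy)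
      _ = _ := (Finset.card_union_of_disjoint hdisj).symm
      _ ≤ T.card := Finset.card_le_card
        (Finset.union_subset (Finset.filter_subset _ _) (Finset.filter_subset _ _))

lemma sum_exp_neg_abs_div_sqrt_le (l : ℕ) (hl : 1 ≤ l) :
    ∑ s ∈ Finset.Icc (-(l : ℤ)) l, Real.exp (-(|(s : ℝ)| / √l)) ≤ 4 * √l := by
  have hs : 1 ≤ √(l : ℝ) := by rw [Real.one_le_sqrt]; exact_mod_cast hl
  have hs0 : 0 < √(l : ℝ) := by linarith
  set q := Real.exp (-(1 / √(l : ℝ))) with hq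
  have hq0 : 0 < q := Real.exp_pos _
  have hq1 : q * (√l + 1) ≤ √l := by
    have h1 : 1 / √(l : ℝ) + 1 ≤ Real.exp (1 / √(l : ℝ)) := Real.add_one_le_exp _
    have h2 : q * Real.exp (1 / √(l : ℝ)) = 1 := by rw [hq, ← Real.exp_add]; simp
    have h3 : q * (1 / √(l : ℝ) + 1) ≤ 1 :=
    (mul_le_mul_of_nonneg_left h1 hq0.le).trans_eq h2
    have h4 : q * (√l + 1) = q * (1 / √(l : ℝ) + 1) * √l := by field_simp; ring
    rw [h4]
    nlinarith
  have hq2 : q < 1 := by nlinarith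
  have heven : Function.Even fun s : ℤ => Real.exp (-(|(s : ℝ)| / √l)) := by
    intro s; simp
  rw [Finset.sum_Icc_of_even_eq_range heven]
  have hpow : ∀ m : ℕ, Real.exp (-(|((m : ℤ) : ℝ)| / √l)) = q ^ m := by
    intro m
    rw [hq, ← Real.exp_nat_mul]
    congr 1
    simp
    ring
  simp only [hpow]
  have hgeom : (∑ m ∈ Finset.range (l + 1), q ^ m) * (1 - q) ≤ 1 := by
    rw [geom_sum_mul_neg]
    have : 0 < q ^ (l + 1) := by positivity
    linarith
  have hG : 0 ≤ ∑ m ∈ Finset.range (l + 1), q ^ m := Finset.sum_nonneg fun _ _ => by positivity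
  have : ∑ m ∈ Finset.range (l + 1), q ^ m ≤ √l + 1 := by
    have h1 : 1 ≤ (1 - q) * (√l + 1) := by linarith
    calc _ ≤ (∑ m ∈ Finset.range (l + 1), q ^ m) * ((1 - q) * (√l + 1)) :=
          le_mul_of_one_le_right hG h1
      _ = (∑ m ∈ Finset.range (l + 1), q ^ m) * (1 - q) * (√l + 1) := by ring
      _ ≤ 1 * (√l + 1) := mul_le_mul_of_nonneg_right hgeom (by linarith)
      _ = _ := one_mul _
  have hz : 0 < Real.exp (-(|((0 : ℤ) : ℝ)| / √l)) := Real.exp_pos _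
  rw [nsmul_eq_mul, Nat.cast_ofNat]
  linarith

lemma sum_units_mul_eq_zero {N : ℕ} {i j : Fin N} (hij : i ≠ j) :
    ∑ u : Fin N → ℤˣ, (((u i : ℤ) : ℝ) * ((u j : ℤ) : ℝ)) = 0 := by
  have h := Equiv.sum_comp (Equiv.mulLeft (Pi.mulSingle i (-1) : Fin N → ℤˣ))
    fun u : Fin N → ℤˣ => (((u i : ℤ) : ℝ) * ((u j : ℤ) : ℝ))
  simp [Pi.mulSingle_eq_of_ne hij.symm] at h
  linarith

lemma card_fun_units (N : ℕ) : Fintype.card (Fin N → ℤˣ) = 2 ^ N := by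
  simp

lemma sum_units_sq {N : ℕ} (s : Finset (Fin N)) :
    ∑ u : Fin N → ℤˣ, (∑ i ∈ s, ((u i : ℤ) : ℝ)) ^ 2 = 2 ^ N * s.card := by
  simp only [sq, Finset.sum_mul_sum]
  rw [Finset.sum_comm]
  have : ∀ i ∈ s, ∑ u : Fin N → ℤˣ, ∑ j ∈ s, (((u i : ℤ) : ℝ) * ((u j : ℤ) : ℝ)) = 2 ^ N := by
    intro i hi
    rw [Finset.sum_comm, Finset.sum_eq_single_of_mem i hi
      fun j _ hj => sum_units_mul_eq_zero hj.symm]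
    have h1 : ∀ u : Fin N → ℤˣ, (((u i : ℤ) : ℝ) * ((u i : ℤ) : ℝ)) = 1 := fun u => by
      rcases Int.units_eq_one_or (u i) with h | h <;> simp [h]
    simp only [h1, Finset.sum_const, Finset.card_univ, card_fun_units]
    simp
  rw [Finset.sum_congr rfl this]
  simp [mul_comm]

lemma sum_units_abs_div_sqrt_le {N l : ℕ} (hl : 1 ≤ l) (s : Finset (Fin N)) (hs : s.card = l) :
    ∑ u : Fin N → ℤˣ, |∑ i ∈ s, ((u i : ℤ) : ℝ)| / √l ≤ 2 ^ N := by
  have hl0 : (0 : ℝ) < l := by exact_mod_cast hl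
  have h1 : ∀ u : Fin N → ℤˣ, |∑ i ∈ s, ((u i : ℤ) : ℝ)| / √l
      ≤ ((∑ i ∈ s, ((u i : ℤ) : ℝ)) ^ 2 / l + 1) / 2 := by
    intro u
    set x := ∑ i ∈ s, ((u i : ℤ) : ℝ)
    have h2 : x ^ 2 / l = (|x| / √l) ^ 2 := by
      rw [div_pow, sq_abs, Real.sq_sqrt hl0.le]
    rw [h2]
    nlinarith [sq_nonneg (|x| / √l - 1)]
  refine (Finset.sum_le_sum fun u _ => h1 u).trans ?_
  rw [← Finset.sum_div, Finset.sum_add_distrib, ← Finset.sum_div, sum_units_sq, hs]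
  simp only [Finset.sum_const, Finset.card_univ, card_fun_units]
  rw [mul_div_cancel_right₀ _ hl0.ne']
  simp

/-- Some prescription of the block sums is met by many assignments. -/
lemma exists_levelSet_large {N l : ℕ} {ι : Type*} [Fintype ι] (hl : 1 ≤ l)
    (B : ι → Finset (Fin N)) (hB : ∀ b, (B b).card = l) :
    ∃ t : ι → ℝ, (2 : ℝ) ^ N / (4 * Real.exp 1 * √l) ^ Fintype.card ι
      ≤ (levelSet B t).ncard := by
  classical
  have hl0 : (0 : ℝ) < √l := by rw [Real.sqrt_pos]; exact_mod_cast hl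
  set D := Fintype.card ι with hD
  let σ : (Fin N → ℤˣ) → ι → ℤ := fun u b => ∑ i ∈ B b, (u i : ℤ)
  let w : (ι → ℤ) → ℝ := fun v => ∑ b, |(v b : ℝ)| / √l
  let V : Finset (ι → ℤ) := Fintype.piFinset fun _ => Finset.Icc (-(l : ℤ)) l
  let n : (ι → ℤ) → ℕ := fun v => (Finset.univ.filter fun u => σ u = v).card
  set M : ℝ := 2 ^ N / (4 * Real.exp 1 * √l) ^ D with hM
  have hσV : ∀ u, σ u ∈ V := by
    intro u
    refine Fintype.mem_piFinset.2 fun b => ?_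
    rw [Finset.mem_Icc, ← abs_le]
    have h1 : ∀ i, |(u i : ℤ)| = 1 := fun i => by
      rcases Int.units_eq_one_or (u i) with h | h <;> simp [h]
    calc |σ u b| ≤ ∑ i ∈ B b, |(u i : ℤ)| := Finset.abs_sum_le_sum_abs _ _
      _ = l := by simp [h1, hB]
  have hmean : ∑ u, w (σ u) ≤ 2 ^ N * D := by
    rw [Finset.sum_comm]
    calc _ ≤ ∑ _b : ι, (2 : ℝ) ^ N := Finset.sum_le_sum fun b _ => by
          simpa [σ] using sum_units_abs_div_sqrt_le hl (B b) (hB b)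
      _ = _ := by simp [hD, mul_comm]
  have hlower : 2 ^ N * Real.exp (-D) ≤ ∑ u, Real.exp (-w (σ u)) := by
    have h1 : ∀ u, Real.exp (-D) * (D - w (σ u) + 1) ≤ Real.exp (-w (σ u)) := by
      intro u
      have : Real.exp (-w (σ u)) = Real.exp (-D) * Real.exp (D - w (σ u)) := by
        rw [← Real.exp_add]; congr 1; ring
      rw [this]
      exact mul_le_mul_of_nonneg_left (Real.add_one_le_exp _) (Real.exp_pos _).le
    refine le_trans ?_ (Finset.sum_le_sum fun u _ => h1 u)
    rw [← Finset.mul_sum, Finset.sum_add_distrib, Finset.sum_sub_distrib]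
    simp only [Finset.sum_const, Finset.card_univ, card_fun_units, nsmul_eq_mul]
    rw [mul_comm]
    refine mul_le_mul_of_nonneg_left ?_ (Real.exp_pos _).le
    push_cast
    linarith
  have hfiber : ∑ u, Real.exp (-w (σ u)) = ∑ v ∈ V, n v * Real.exp (-w v) := by
    rw [← Finset.sum_fiberwise_of_maps_to (fun u _ => hσV u)]
    refine Finset.sum_congr rfl fun v _ => ?_
    rw [Finset.sum_congr rfl fun u hu => by rw [(Finset.mem_filter.1 hu).2]]
    simp [n]
  have hweight : ∑ v ∈ V, Real.exp (-w v) ≤ (4 * √l) ^ D := by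
    have : ∀ v ∈ V, Real.exp (-w v) = ∏ b, Real.exp (-(|(v b : ℝ)| / √l)) := fun v _ => by
      rw [← Real.exp_sum, Finset.sum_neg_distrib]
    rw [Finset.sum_congr rfl this, ← Finset.prod_univ_sum
      (fun _ : ι => Finset.Icc (-(l : ℤ)) l) fun _ s => Real.exp (-(|(s : ℝ)| / √l))]
    rw [Finset.prod_const, Finset.card_univ, ← hD]
    exact pow_le_pow_left₀ (Finset.sum_nonneg fun _ _ => (Real.exp_pos _).le)
      (sum_exp_neg_abs_div_sqrt_le l hl) D
  have hM0 : 0 ≤ M := by positivity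
  have hMD : M * (4 * √l) ^ D = 2 ^ N * Real.exp (-D) := by
    have h1 : Real.exp (-D) = (Real.exp 1 ^ D)⁻¹ := by
      rw [Real.exp_neg, ← Real.exp_nat_mul, mul_one]
    rw [hM, h1, mul_pow, mul_pow, mul_pow]
    field_simp
  have hVne : V.Nonempty := ⟨σ 1, hσV 1⟩
  obtain ⟨v, -, hv⟩ := Finset.exists_le_of_sum_le (f := fun v => M * Real.exp (-w v)) hVne
    (show ∑ v ∈ V, M * Real.exp (-w v) ≤ ∑ v ∈ V, n v * Real.exp (-w v) by
      rw [← Finset.mul_sum, ← hfiber]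
      exact (mul_le_mul_of_nonneg_left hweight hM0).trans (hMD.le.trans hlower))
  have hvM : M ≤ n v := le_of_mul_le_mul_right hv (Real.exp_pos _)
  refine ⟨fun b => v b, hvM.trans ?_⟩
  have hfin : (levelSet B fun b => (v b : ℝ)).Finite := by
    refine (Set.Finite.pi' fun _ : Fin N => Set.toFinite ({-1, 1} : Set ℝ)).subset ?_
    intro S hS i
    simpa using hS.1 i
  have hinj : Function.Injective fun (u : Fin N → ℤˣ) (i : Fin N) => ((u i : ℤ) : ℝ) := by
    intro u u' h
    funext i
    exact Units.ext (Int.cast_injective (congrFun h i))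
  have : n v ≤ (levelSet B fun b => (v b : ℝ)).ncard := by
    simp only [n]
    rw [← Set.ncard_coe_finset]
    refine Set.ncard_le_ncard_of_injOn (fun u i => ((u i : ℤ) : ℝ)) ?_ hinj.injOn hfin
    intro u hu
    have hu : σ u = v := by simpa using hu
    refine ⟨fun i => ?_, fun b => ?_⟩
    · rcases Int.units_eq_one_or (u i) with h | h <;> simp [h]
    · rw [← hu]; simp [σ]
  exact_mod_cast this

/-- The axis-parallel lines in `m` disjoint copies of a grid of side `l` and dimension `n + 1`. -/
def gridLine {N m n l : ℕ} (e : Fin N ≃ Fin m × (Fin (n + 1) → Fin l))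
    (b : Fin m × Fin (n + 1) × (Fin n → Fin l)) : Finset (Fin N) :=
  Finset.univ.filter fun i => (e i).1 = b.1 ∧ b.2.1.removeNth (e i).2 = b.2.2

lemma card_gridLine {N m n l : ℕ} (e : Fin N ≃ Fin m × (Fin (n + 1) → Fin l))
    (b : Fin m × Fin (n + 1) × (Fin n → Fin l)) : (gridLine e b).card = l := by
  obtain ⟨c, k, y⟩ := b
  have : gridLine e (c, k, y) = Finset.univ.image
      fun a : Fin l => e.symm (c, k.insertNth a y) := by
    ext i
    simp only [gridLine, Finset.mem_filter, Finset.mem_univ, true_and, Finset.mem_image]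
    constructor
    · rintro ⟨rfl, rfl⟩
      exact ⟨(e i).2 k, by rw [Equiv.symm_apply_eq]; simp⟩
    · rintro ⟨a, rfl⟩
      simp
  rw [this, Finset.card_image_of_injective, Finset.card_univ, Fintype.card_fin]
  intro a a' h
  have h := congrArg (fun p => p.2 k) (e.symm.injective h)
  simpa using h

lemma degreeJ_gridLine_le {N m n l : ℕ} (e : Fin N ≃ Fin m × (Fin (n + 1) → Fin l))
    (i : Fin N) : degreeJ (blockCoupling (gridLine e)) i ≤ (n + 1) * (l - 1) := by
  let L : Fin (n + 1) → Finset (Fin N) := fun k => gridLine e ((e i).1, k, k.removeNth (e i).2)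
  have hsub : {j | j ≠ i ∧ blockCoupling (gridLine e) i j ≠ 0} ⊆
      ((Finset.univ.biUnion fun k => (L k).erase i : Finset (Fin N)) : Set (Fin N)) := by
    rintro j ⟨hji, hJ⟩
    rw [blockCoupling, if_neg hji.symm] at hJ
    obtain ⟨⟨c, k, y⟩, -, hb⟩ := Finset.exists_ne_zero_of_sum_ne_zero hJ
    have hb : i ∈ gridLine e (c, k, y) ∧ j ∈ gridLine e (c, k, y) := by
      by_contra h
      simp [h] at hb
    have hi := hb.1
    simp only [gridLine, Finset.mem_filter, Finset.mem_univ, true_and] at hi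
    obtain ⟨rfl, rfl⟩ := hi
    simp only [Finset.coe_biUnion, Set.mem_iUnion]
    exact ⟨k, Finset.mem_coe.2 (Finset.mem_univ k), by simp [hji, L, hb.2]⟩
  calc degreeJ (blockCoupling (gridLine e)) i
      ≤ (Finset.univ.biUnion fun k => (L k).erase i).card := by
        rw [← Set.ncard_coe_finset]
        exact Set.ncard_le_ncard hsub (Finset.finite_toSet _)
    _ ≤ ∑ k, ((L k).erase i).card := Finset.card_biUnion_le
    _ = ∑ _k : Fin (n + 1), (l - 1) := Finset.sum_congr rfl fun k _ => by
        rw [Finset.card_erase_of_mem (by simp [L, gridLine]), card_gridLine]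
    _ = _ := by simp

lemma two_pow_le_ncard_ne {N m n l : ℕ} (e : Fin N ≃ Fin m × (Fin (n + 1) → Fin l))
    {S S' : Fin N → ℝ} (hsum : ∀ b, ∑ i ∈ gridLine e b, S i = ∑ i ∈ gridLine e b, S' i)
    (hne : S' ≠ S) : 2 ^ (n + 1) ≤ Set.ncard {i | S i ≠ S' i} := by
  classical
  obtain ⟨i, hi⟩ := Function.ne_iff.1 hne.symm
  let T : Finset (Fin (n + 1) → Fin l) :=
    Finset.univ.filter fun x => S (e.symm ((e i).1, x)) ≠ S' (e.symm ((e i).1, x))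
  have hT : 2 ^ (n + 1) ≤ T.card := by
    apply two_pow_le_card_of_no_isolated
    · exact ⟨(e i).2, by simpa [T] using hi⟩
    · intro k x hx
      have hx : S (e.symm ((e i).1, x)) ≠ S' (e.symm ((e i).1, x)) := by simpa [T] using hx
      obtain ⟨j, hj, hjx, hjd⟩ := exists_ne_of_sum_eq (hsum ((e i).1, k, k.removeNth x))
        (by simp [gridLine]) hx
      simp only [gridLine, Finset.mem_filter, Finset.mem_univ, true_and] at hj
      have hj' : e.symm ((e i).1, (e j).2) = j := by
        rw [Equiv.symm_apply_eq, ← hj.1]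
      refine ⟨(e j).2, by simpa [T, hj'] using hjd, ?_, ?_⟩
      · rintro h
        rw [← h, hj'] at hjx
        exact hjx rfl
      · intro a ha
        obtain ⟨a', rfl⟩ := Fin.exists_succAbove_eq ha
        exact congrFun hj.2 a'
  refine hT.trans ?_
  rw [← Set.ncard_coe_finset]
  refine Set.ncard_le_ncard_of_injOn (fun x => e.symm ((e i).1, x)) ?_ ?_ (Set.toFinite _)
  · intro x hx
    simpa [T] using hx
  · intro x _ y _ h
    simpa using h

/-- there is `c > 0` such that for every `f ≥ 1`, even `l ≥ 2`, and `N` a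
positive multiple of `l^f`, there is an Ising instance on `N` variables of maximum degree
at most `f·(l-1)` with at least `2^{N(1 - f·log₂(f√l/c)/l)}` global minima, every one of
which is a `(2^f - 1)`-minimum. -/
theorem stmt8 :
    ∃ c : ℝ, 0 < c ∧
      ∀ f l N : ℕ, 1 ≤ f → 2 ≤ l → Even l → 0 < N → l ^ f ∣ N →
        ∃ (h : Fin N → ℝ) (J : Fin N → Fin N → ℝ),
          (∀ i j, J i j = J j i) ∧ (∀ i, J i i = 0) ∧
          (∀ i, degreeJ J i ≤ f * (l - 1)) ∧
          ((2 : ℝ) ^ ((N : ℝ) * (1 - f * Real.logb 2 (f * Real.sqrt l / c) / l)) ≤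
            (Set.ncard {S : Fin N → ℝ | IsingGlobalMin h J S} : ℝ)) ∧
          ∀ S, IsingGlobalMin h J S → IsingKMin h J (2 ^ f - 1) S := by
  refine ⟨1 / (4 * Real.exp 1), by positivity, ?_⟩
  intro f l N hf hl _ hN hdvd
  obtain ⟨n, rfl⟩ : ∃ n, f = n + 1 := ⟨f - 1, by omega⟩
  obtain ⟨m, hm⟩ := hdvd
  have e : Fin N ≃ Fin m × (Fin (n + 1) → Fin l) :=
    Fintype.equivOfCardEq (by simp [hm, mul_comm])
  obtain ⟨t, ht⟩ := exists_levelSet_large (by omega) (gridLine e) (card_gridLine e)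
  have hl0 : (0 : ℝ) < l := by exact_mod_cast (by omega : 0 < l)
  have hsq : 0 < √(l : ℝ) := Real.sqrt_pos.2 hl0
  have hne : (levelSet (gridLine e) t).Nonempty := by
    apply Set.nonempty_of_ncard_ne_zero
    intro h
    rw [h, Nat.cast_zero] at ht
    exact absurd ht (not_le.2 (by positivity))
  have hiff := isingGlobalMin_iff_mem_levelSet (gridLine e) t hne
  refine ⟨blockField (gridLine e) t, blockCoupling (gridLine e), blockCoupling_comm _,
    fun i => by simp [blockCoupling], degreeJ_gridLine_le e, ?_, ?_⟩
  · have hset : {S | IsingGlobalMin (blockField (gridLine e) t) (blockCoupling (gridLine e)) S}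
        = levelSet (gridLine e) t := Set.ext hiff
    rw [hset]
    refine le_trans ?_ ht
    set D := Fintype.card (Fin m × Fin (n + 1) × (Fin n → Fin l)) with hD
    have hDl : (D : ℝ) * l = N * ((n + 1 : ℕ) : ℝ) := by
      have : D * l = N * (n + 1) := by
        simp only [hD, Fintype.card_prod, Fintype.card_fin, Fintype.card_pi, Finset.prod_const,
          Finset.card_univ, hm]
        ring
      exact_mod_cast this
    set x : ℝ := ((n + 1 : ℕ) : ℝ) * √l / (1 / (4 * Real.exp 1)) with hx
    have hx0 : 0 < x := by positivity
    have hyx : 4 * Real.exp 1 * √l ≤ x := by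
      have h1 : x = ((n + 1 : ℕ) : ℝ) * (4 * Real.exp 1 * √l) := by
        rw [hx, div_div_eq_mul_div, div_one]; ring
      rw [h1]
      refine le_mul_of_one_le_left (by positivity) ?_
      exact_mod_cast hf
    have hexp : (N : ℝ) * (1 - ((n + 1 : ℕ) : ℝ) * Real.logb 2 x / l)
        = N - Real.logb 2 x * D := by
      have : (D : ℝ) = N * ((n + 1 : ℕ) : ℝ) / l := by rw [← hDl]; field_simp
      rw [this]
      ring
    rw [hexp, Real.rpow_sub two_pos, Real.rpow_natCast, Real.rpow_mul two_pos.le,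
      Real.rpow_logb two_pos (by norm_num) hx0, Real.rpow_natCast]
    gcongr
  · intro S hS
    refine ⟨hS.1, fun S' hS' hne' hcard => ?_⟩
    refine lt_of_le_of_ne (hS.2 S' hS') fun heq => ?_
    have hS'min : IsingGlobalMin (blockField (gridLine e) t) (blockCoupling (gridLine e)) S' :=
      ⟨hS', fun S'' h => heq ▸ hS.2 S'' h⟩
    have h1 := ((hiff S).1 hS).2
    have h2 := ((hiff S').1 hS'min).2
    have h3 := two_pow_le_ncard_ne e (fun b => (h1 b).trans (h2 b).symm) hne'
    have h4 : 0 < 2 ^ (n + 1) := by positivity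
    omega
end

section
/- There exists a constant C > 0 such that for every integer N ≥ 2, every Ising instance on N variables has at most C·(log₂ N)^{5/2}·2^N/√N local minima. -/
open Finset

/-- The finite set of all assignments. -/
noncomputable def assignments (N : ℕ) : Finset (Fin N → ℝ) :=
  Fintype.piFinset fun _ => {-1, 1}

/-- The effective field acting on the spin `i`. -/
noncomputable def localField {N : ℕ} (h : Fin N → ℝ) (J : Fin N → Fin N → ℝ)
    (i : Fin N) (S : Fin N → ℝ) : ℝ :=
  h i + ∑ j, J i j * S j

/-- The sign of the effective field, with value `-1` at zero field. -/
noncomputable def fieldSign {N : ℕ} (h : Fin N → ℝ) (J : Fin N → Fin N → ℝ)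
    (i : Fin N) (S : Fin N → ℝ) : ℝ :=
  if 0 < localField h J i S then 1 else -1

/-- The sign of a coupling, with value `1` at zero. -/
noncomputable def couplingSign (x : ℝ) : ℝ := if 0 ≤ x then 1 else -1

section

variable {N : ℕ} {h : Fin N → ℝ} {J : Fin N → Fin N → ℝ}

lemma mem_assignments {S : Fin N → ℝ} : S ∈ assignments N ↔ IsAssignment S := by
  simp [assignments, IsAssignment]

lemma card_assignments : (assignments N).card = 2 ^ N := by
  have : ((-1 : ℝ)) ≠ 1 := by norm_num
  simp [assignments, Finset.card_pair this]

lemma flipAt_self (S : Fin N → ℝ) (i : Fin N) : flipAt S i i = -S i := by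
  simp [flipAt]

lemma flipAt_of_ne (S : Fin N → ℝ) {i j : Fin N} (hij : j ≠ i) : flipAt S i j = S j := by
  simp [flipAt, hij]

lemma flipAt_eq_add (S : Fin N → ℝ) (i j : Fin N) :
    flipAt S i j = S j + if j = i then -2 * S i else 0 := by
  by_cases hij : j = i
  · subst hij
    rw [flipAt_self, if_pos rfl]
    ring
  · rw [flipAt_of_ne S hij, if_neg hij, add_zero]

lemma flipAt_flipAt (S : Fin N → ℝ) (i : Fin N) : flipAt (flipAt S i) i = S := by
  simp [flipAt]

lemma IsAssignment.flipAt {S : Fin N → ℝ} (hS : IsAssignment S) (i : Fin N) :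
    IsAssignment (flipAt S i) := by
  intro j
  by_cases hij : j = i
  · subst hij
    rw [flipAt_self]
    rcases hS j with hj | hj <;> simp [hj]
  · rw [flipAt_of_ne S hij]
    exact hS j

lemma sum_assignments_flipAt (i : Fin N) (g : (Fin N → ℝ) → ℝ) :
    ∑ S ∈ assignments N, g (flipAt S i) = ∑ S ∈ assignments N, g S := by
  refine Finset.sum_nbij' (fun S => flipAt S i) (fun S => flipAt S i) ?_ ?_ ?_ ?_ ?_
  · exact fun S hS => mem_assignments.2 ((mem_assignments.1 hS).flipAt i)
  · exact fun S hS => mem_assignments.2 ((mem_assignments.1 hS).flipAt i)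
  · exact fun S _ => flipAt_flipAt S i
  · exact fun S _ => flipAt_flipAt S i
  · exact fun S _ => rfl

lemma sum_assignments_mul_of_flipAt_eq (i : Fin N) (g : (Fin N → ℝ) → ℝ)
    (hg : ∀ S, g (flipAt S i) = g S) : ∑ S ∈ assignments N, S i * g S = 0 := by
  have key := sum_assignments_flipAt i fun S => S i * g S
  simp only [hg, flipAt_self, neg_mul, Finset.sum_neg_distrib] at key
  linarith

lemma localField_flipAt (S : Fin N → ℝ) (i j : Fin N) :
    localField h J i (flipAt S j) = localField h J i S - 2 * J i j * S j := by
  simp only [localField, flipAt_eq_add, mul_add, Finset.sum_add_distrib, mul_ite, mul_zero,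
    Finset.sum_ite_eq', Finset.mem_univ, if_true]
  ring

lemma fieldSign_eq (i : Fin N) (S : Fin N → ℝ) :
    fieldSign h J i S = -1 ∨ fieldSign h J i S = 1 := by
  unfold fieldSign
  split_ifs <;> simp

lemma fieldSign_flipAt_self (hdiag : ∀ i, J i i = 0) (i : Fin N) (S : Fin N → ℝ) :
    fieldSign h J i (flipAt S i) = fieldSign h J i S := by
  simp [fieldSign, localField_flipAt, hdiag]

lemma couplingSign_eq (x : ℝ) : couplingSign x = -1 ∨ couplingSign x = 1 := by
  unfold couplingSign
  split_ifs <;> simp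

lemma couplingSign_mul_fieldSign_sub_nonneg {S : Fin N → ℝ} (hS : IsAssignment S)
    (i j : Fin N) :
    0 ≤ couplingSign (J i j) * S j *
      (fieldSign h J i S - fieldSign h J i (flipAt S j)) := by
  unfold fieldSign couplingSign
  rw [localField_flipAt]
  rcases hS j with hj | hj <;> rw [hj] <;> split_ifs <;> first | (exfalso; linarith) | norm_num

lemma energy_eq_half_sum (hsymm : ∀ i j, J i j = J j i) (hdiag : ∀ i, J i i = 0)
    (S : Fin N → ℝ) :
    energy h J S = ∑ i, h i * S i + (∑ i, ∑ j, J i j * S i * S j) / 2 := by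
  have hswap : (∑ i, ∑ j, if i < j then J i j * S i * S j else 0) =
      ∑ i, ∑ j, if j < i then J i j * S i * S j else 0 := by
    rw [Finset.sum_comm]
    refine Finset.sum_congr rfl fun i _ => Finset.sum_congr rfl fun j _ => ?_
    rw [hsymm j i]
    split_ifs <;> ring
  have hsplit : (∑ i, ∑ j, J i j * S i * S j) =
      (∑ i, ∑ j, if i < j then J i j * S i * S j else 0) +
        ∑ i, ∑ j, if j < i then J i j * S i * S j else 0 := by
    simp only [← Finset.sum_add_distrib]
    refine Finset.sum_congr rfl fun i _ => Finset.sum_congr rfl fun j _ => ?_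
    rcases lt_trichotomy i j with hij | hij | hij
    · simp [hij, hij.not_gt]
    · subst hij
      simp [hdiag]
    · simp [hij, hij.not_gt]
  rw [energy, hsplit, ← hswap]
  ring

lemma energy_flipAt (hsymm : ∀ i j, J i j = J j i) (hdiag : ∀ i, J i i = 0)
    (S : Fin N → ℝ) (i : Fin N) :
    energy h J (flipAt S i) = energy h J S - 2 * (S i * localField h J i S) := by
  have hcol : ∑ a, J a i * S a = ∑ a, J i a * S a :=
    Finset.sum_congr rfl fun a _ => by rw [hsymm a i]
  have hpair : ∑ a, ∑ b, J a b * flipAt S i a * flipAt S i b =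
      (∑ a, ∑ b, J a b * S a * S b) - 4 * S i * ∑ b, J i b * S b := by
    have hrow : ∀ a, ∑ b, J a b * flipAt S i a * flipAt S i b =
        (∑ b, J a b * S b - 2 * J a i * S i) * flipAt S i a := by
      intro a
      have := localField_flipAt (h := fun _ => 0) (J := J) S a i
      simp only [localField, zero_add] at this
      rw [← this, Finset.sum_mul]
      exact Finset.sum_congr rfl fun b _ => by ring
    have hrow' : ∀ a, ∑ b, J a b * S a * S b = (∑ b, J a b * S b) * S a := by
      intro a
      rw [Finset.sum_mul]
      exact Finset.sum_congr rfl fun b _ => by ring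
    simp only [hrow, hrow']
    simp only [flipAt_eq_add, mul_add, Finset.sum_add_distrib, mul_ite, mul_zero,
      Finset.sum_ite_eq', Finset.mem_univ, if_true, sub_mul, Finset.sum_sub_distrib, hdiag]
    have : ∑ a, 2 * J a i * S i * S a = 2 * S i * ∑ a, J i a * S a := by
      rw [← hcol, Finset.mul_sum]
      exact Finset.sum_congr rfl fun a _ => by ring
    rw [this]
    ring
  have hfield : ∑ a, h a * flipAt S i a = ∑ a, h a * S a - 2 * (S i * h i) := by
    simp only [flipAt_eq_add, mul_add, Finset.sum_add_distrib, mul_ite, mul_zero,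
      Finset.sum_ite_eq', Finset.mem_univ, if_true]
    ring
  rw [energy_eq_half_sum hsymm hdiag, energy_eq_half_sum hsymm hdiag, hpair, hfield, localField]
  ring

lemma IsingLocalMin.mul_fieldSign (hsymm : ∀ i j, J i j = J j i) (hdiag : ∀ i, J i i = 0)
    {S : Fin N → ℝ} (hS : IsingLocalMin h J S) (i : Fin N) :
    S i * fieldSign h J i S = -1 := by
  have hlt := hS.2 i
  rw [energy_flipAt hsymm hdiag] at hlt
  unfold fieldSign
  rcases hS.1 i with hi | hi <;> rw [hi] at hlt ⊢ <;> split_ifs <;>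
    first | (exfalso; linarith) | norm_num

/-- The correlation of two signed fields is at most the influence of the second spin on the
first field. -/
lemma sum_mul_fieldSign_le_of_ne (hdiag : ∀ i, J i i = 0) {i j : Fin N} (hij : i ≠ j) :
    ∑ S ∈ assignments N, (S i * fieldSign h J i S) * (S j * fieldSign h J j S) ≤
      ∑ S ∈ assignments N, couplingSign (J i j) * S j * fieldSign h J i S := by
  set Q : (Fin N → ℝ) → ℝ :=
    fun S => (S i * fieldSign h J i S) * (S j * fieldSign h J j S) with hQ
  set R : (Fin N → ℝ) → ℝ :=
    fun S => couplingSign (J i j) * S j * fieldSign h J i S with hR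
  have hQ_sum : ∑ S ∈ assignments N,
      (Q S + Q (flipAt S i) + Q (flipAt S j) + Q (flipAt (flipAt S i) j)) =
        4 * ∑ S ∈ assignments N, Q S := by
    simp only [Finset.sum_add_distrib]
    rw [sum_assignments_flipAt i fun S => Q (flipAt S j), sum_assignments_flipAt j Q,
      sum_assignments_flipAt i Q]
    ring
  have hR_sum : ∑ S ∈ assignments N, (R S + R (flipAt S j)) =
      2 * ∑ S ∈ assignments N, R S := by
    rw [Finset.sum_add_distrib, sum_assignments_flipAt j R]
    ring
  have hle : ∑ S ∈ assignments N,
      (Q S + Q (flipAt S i) + Q (flipAt S j) + Q (flipAt (flipAt S i) j)) ≤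
        ∑ S ∈ assignments N, 2 * (R S + R (flipAt S j)) := by
    refine Finset.sum_le_sum fun S hS => ?_
    have hS := mem_assignments.1 hS
    have hcomm : flipAt (flipAt S i) j = flipAt (flipAt S j) i := by
      simp only [flipAt, Function.update_of_ne hij, Function.update_of_ne hij.symm]
      exact Function.update_comm hij _ _ _
    have hmono := couplingSign_mul_fieldSign_sub_nonneg (h := h) (J := J) hS i j
    have hi : fieldSign h J i (flipAt (flipAt S i) j) = fieldSign h J i (flipAt S j) := by
      rw [hcomm, fieldSign_flipAt_self hdiag]
    simp only [hQ, hR, hi, fieldSign_flipAt_self hdiag, flipAt_self, flipAt_of_ne _ hij,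
      flipAt_of_ne _ hij.symm]
    rcases hS i with h1 | h1 <;> rcases hS j with h2 | h2 <;>
      rcases couplingSign_eq (J i j) with h3 | h3 <;>
      rcases fieldSign_eq (h := h) (J := J) j S with h4 | h4 <;>
      rcases fieldSign_eq (h := h) (J := J) j (flipAt S i) with h5 | h5 <;>
      simp only [h1, h2, h3, h4, h5] at hmono ⊢ <;> linarith
  rw [hQ_sum, ← Finset.mul_sum, hR_sum] at hle
  linarith

lemma sum_mul_fieldSign_le (hdiag : ∀ i, J i i = 0) (i j : Fin N) :
    ∑ S ∈ assignments N, (S i * fieldSign h J i S) * (S j * fieldSign h J j S) ≤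
      (if i = j then (2 : ℝ) ^ N else 0) +
        ∑ S ∈ assignments N, couplingSign (J i j) * S j * fieldSign h J i S := by
  by_cases hij : i = j
  · subst hij
    have hzero : ∑ S ∈ assignments N, couplingSign (J i i) * S i * fieldSign h J i S = 0 := by
      simp only [mul_assoc]
      rw [← Finset.mul_sum, sum_assignments_mul_of_flipAt_eq i _ (fieldSign_flipAt_self hdiag i),
        mul_zero]
    have hone : ∀ S ∈ assignments N,
        (S i * fieldSign h J i S) * (S i * fieldSign h J i S) = 1 := by
      intro S hS
      rcases mem_assignments.1 hS i with h1 | h1 <;>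
        rcases fieldSign_eq (h := h) (J := J) i S with h2 | h2 <;> rw [h1, h2] <;> norm_num
    rw [hzero, Finset.sum_congr rfl hone]
    simp [card_assignments]
  · rw [if_neg hij, zero_add]
    exact sum_mul_fieldSign_le_of_ne hdiag hij

lemma sum_assignments_sq_linear (c : Fin N → ℝ) :
    ∑ S ∈ assignments N, (∑ j, c j * S j) ^ 2 = 2 ^ N * ∑ j, c j ^ 2 := by
  have horth : ∀ j k : Fin N, ∑ S ∈ assignments N, (c j * S j) * (c k * S k) =
      if j = k then 2 ^ N * c j ^ 2 else 0 := by
    intro j k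
    split_ifs with hjk
    · subst hjk
      have hsq : ∀ S ∈ assignments N, (c j * S j) * (c j * S j) = c j ^ 2 := by
        intro S hS
        rcases mem_assignments.1 hS j with h1 | h1 <;> rw [h1] <;> ring
      rw [Finset.sum_congr rfl hsq]
      simp [card_assignments]
    · have := sum_assignments_mul_of_flipAt_eq j (fun S => c j * (c k * S k))
        fun S => by rw [flipAt_of_ne S (Ne.symm hjk)]
      rw [← this]
      exact Finset.sum_congr rfl fun S _ => by ring
  simp only [sq (∑ j, c j * _), Finset.sum_mul_sum]
  rw [Finset.sum_comm]
  simp only [Finset.sum_comm (s := assignments N), horth, Finset.sum_ite_eq, Finset.mem_univ,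
    if_true, Finset.mul_sum]

/-- The total influence of a linear threshold function is at most `√N`. -/
lemma sum_couplingSign_le (hN : 0 < N) (i : Fin N) :
    ∑ j, ∑ S ∈ assignments N, couplingSign (J i j) * S j * fieldSign h J i S ≤
      2 ^ N * Real.sqrt N := by
  have hpos : 0 < Real.sqrt N := Real.sqrt_pos.2 (by exact_mod_cast hN)
  have hsq : Real.sqrt N ^ 2 = N := Real.sq_sqrt (Nat.cast_nonneg N)
  rw [Finset.sum_comm]
  have hlin : ∑ S ∈ assignments N, (∑ j, couplingSign (J i j) * S j) ^ 2 = 2 ^ N * N := by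
    rw [sum_assignments_sq_linear]
    have : ∀ j, couplingSign (J i j) ^ 2 = 1 := fun j => by
      rcases couplingSign_eq (J i j) with h1 | h1 <;> rw [h1] <;> norm_num
    simp [this]
  have hle : ∑ S ∈ assignments N,
      2 * Real.sqrt N * ∑ j, couplingSign (J i j) * S j * fieldSign h J i S ≤
      ∑ S ∈ assignments N, ((N : ℝ) + (∑ j, couplingSign (J i j) * S j) ^ 2) := by
    refine Finset.sum_le_sum fun S _ => ?_
    rw [← Finset.sum_mul]
    rcases fieldSign_eq (h := h) (J := J) i S with h1 | h1 <;> rw [h1]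
    · linarith [hsq, sq_nonneg (Real.sqrt N + ∑ j, couplingSign (J i j) * S j)]
    · linarith [hsq, sq_nonneg (Real.sqrt N - ∑ j, couplingSign (J i j) * S j)]
  rw [← Finset.mul_sum, Finset.sum_add_distrib, hlin, Finset.sum_const, card_assignments,
    nsmul_eq_mul] at hle
  push_cast at hle
  refine le_of_mul_le_mul_left (hle.trans (le_of_eq ?_)) (by positivity : 0 < 2 * Real.sqrt N)
  linear_combination (-2 : ℝ) * 2 ^ N * hsq

lemma sum_sq_sum_mul_fieldSign_le (hN : 0 < N) (hdiag : ∀ i, J i i = 0) :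
    ∑ S ∈ assignments N, (∑ i, S i * fieldSign h J i S) ^ 2 ≤
      2 ^ N * (N * (1 + Real.sqrt N)) := by
  calc ∑ S ∈ assignments N, (∑ i, S i * fieldSign h J i S) ^ 2
      = ∑ i, ∑ j, ∑ S ∈ assignments N,
          (S i * fieldSign h J i S) * (S j * fieldSign h J j S) := by
        simp only [sq, Finset.sum_mul_sum]
        rw [Finset.sum_comm]
        exact Finset.sum_congr rfl fun i _ => Finset.sum_comm
    _ ≤ ∑ i, ∑ j, ((if i = j then (2 : ℝ) ^ N else 0) +
          ∑ S ∈ assignments N, couplingSign (J i j) * S j * fieldSign h J i S) :=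
        Finset.sum_le_sum fun i _ => Finset.sum_le_sum fun j _ => sum_mul_fieldSign_le hdiag i j
    _ ≤ ∑ _i : Fin N, ((2 : ℝ) ^ N + 2 ^ N * Real.sqrt N) := by
        refine Finset.sum_le_sum fun i _ => ?_
        rw [Finset.sum_add_distrib, Finset.sum_ite_eq, if_pos (Finset.mem_univ i)]
        exact add_le_add_right (sum_couplingSign_le hN i) _
    _ = 2 ^ N * (N * (1 + Real.sqrt N)) := by
        rw [Finset.sum_const, Finset.card_univ, Fintype.card_fin, nsmul_eq_mul]
        ring

lemma ncard_isingLocalMin_le (hN : 0 < N) (hsymm : ∀ i j, J i j = J j i)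
    (hdiag : ∀ i, J i i = 0) :
    (Set.ncard {S : Fin N → ℝ | IsingLocalMin h J S} : ℝ) ≤ 2 * 2 ^ N / Real.sqrt N := by
  classical
  have hset : {S : Fin N → ℝ | IsingLocalMin h J S} =
      ((assignments N).filter (IsingLocalMin h J) : Finset (Fin N → ℝ)) := by
    ext S
    simp only [Set.mem_ofPred_eq, Finset.coe_filter, mem_assignments]
    exact ⟨fun hS => ⟨hS.1, hS⟩, fun hS => hS.2⟩
  rw [hset, Set.ncard_coe_finset]
  set A := (assignments N).filter (IsingLocalMin h J)
  have hN' : (1 : ℝ) ≤ N := by exact_mod_cast hN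
  have hsqrt : 1 ≤ Real.sqrt N := Real.one_le_sqrt.2 hN'
  have hsq : Real.sqrt N * Real.sqrt N = N := Real.mul_self_sqrt (Nat.cast_nonneg N)
  have hcount : (A.card : ℝ) * N ^ 2 ≤
      ∑ S ∈ assignments N, (∑ i, S i * fieldSign h J i S) ^ 2 := by
    calc (A.card : ℝ) * N ^ 2 = ∑ S ∈ A, (∑ i, S i * fieldSign h J i S) ^ 2 := by
          rw [Finset.sum_congr rfl (g := fun _ => (N : ℝ) ^ 2)]
          · simp
          · intro S hS
            have hS := (Finset.mem_filter.1 hS).2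
            simp [hS.mul_fieldSign hsymm hdiag]
      _ ≤ _ := Finset.sum_le_sum_of_subset_of_nonneg (Finset.filter_subset _ _)
          fun _ _ _ => sq_nonneg _
  have hbound : (A.card : ℝ) * N ^ 2 ≤ 2 ^ N * (N * (2 * Real.sqrt N)) :=
    (hcount.trans (sum_sq_sum_mul_fieldSign_le hN hdiag)).trans (by gcongr; linarith)
  rw [le_div_iff₀ (by linarith)]
  refine le_of_mul_le_mul_right ?_ (by positivity : (0 : ℝ) < N * Real.sqrt N)
  calc (A.card : ℝ) * Real.sqrt N * (N * Real.sqrt N)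
      = A.card * N ^ 2 := by linear_combination (A.card : ℝ) * N * hsq
    _ ≤ 2 ^ N * (N * (2 * Real.sqrt N)) := hbound
    _ = 2 * 2 ^ N * (N * Real.sqrt N) := by ring

end

/-- there is `C > 0` such that every Ising instance on `N ≥ 2` variables has
at most `C·(log₂ N)^{5/2}·2^N/√N` local minima. -/
theorem stmt14 :
    ∃ C : ℝ, 0 < C ∧
      ∀ (N : ℕ) (h : Fin N → ℝ) (J : Fin N → Fin N → ℝ),
        2 ≤ N → (∀ i j, J i j = J j i) → (∀ i, J i i = 0) →
        (Set.ncard {S : Fin N → ℝ | IsingLocalMin h J S} : ℝ) ≤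
          C * Real.logb 2 N ^ ((5 : ℝ) / 2) * 2 ^ N / Real.sqrt N := by
  refine ⟨2, two_pos, fun N h J hN hsymm hdiag => ?_⟩
  refine (ncard_isingLocalMin_le (by omega) hsymm hdiag).trans ?_
  have hlog : 1 ≤ Real.logb 2 N := by
    rw [Real.le_logb_iff_rpow_le one_lt_two (by positivity), Real.rpow_one]
    exact_mod_cast hN
  have hpow : 1 ≤ Real.logb 2 N ^ ((5 : ℝ) / 2) := Real.one_le_rpow hlog (by norm_num)
  gcongr
  linarith
end

section
/- There exist constants ε₀ > 0 and c > 0 such that the following holds. Let an Ising instance on N variables have a graph of maximum degree at most d, and let 0 < ε ≤ ε₀ with N sufficiently large depending on ε. Then there exists a set T of variables with |T| ≥ c·ε·N such that, writing D = ⌊(1/99)·ε^{−1}⌋: (1) every i ∈ T has at most 99·ε·d neighbors inside T; (2) every i ∈ T having at least one neighbor inside T has at least D variables j ∉ T with |J i j| ≥ max_{k ∈ T} |J i k|; and (3) to each such i one can assign a set E_i of exactly D variables j ∉ T with |J i j| ≥ max_{k ∈ T} |J i k| (the 'strong edges' of i) in such a way that for every i ∈ T, the sum over neighbors j ∉ T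 of i of the number of indices k ∈ T with j ∈ E_k is at most 99·d. -/
open Finset

open scoped Classical

/-- A finset has a subset of any prescribed admissible size consisting of largest elements. -/
theorem exists_subset_card_eq_forall_le {α : Type*} (s : Finset α) (g : α → ℝ) (n : ℕ)
    (hn : n ≤ s.card) :
    ∃ t ⊆ s, t.card = n ∧ ∀ j ∈ t, ∀ k ∈ s, k ∉ t → g k ≤ g j := by
  induction n with
  | zero => exact ⟨∅, by simp, by simp, by simp⟩
  | succ n ih =>
    obtain ⟨t, hts, hcard, hmax⟩ := ih (by omega)
    have hne : (s \ t).Nonempty := by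
      rw [← Finset.card_pos, Finset.card_sdiff_of_subset hts]
      omega
    obtain ⟨a, ha, hamax⟩ := Finset.exists_max_image (s \ t) g hne
    rw [Finset.mem_sdiff] at ha
    refine ⟨insert a t, Finset.insert_subset ha.1 hts, ?_, ?_⟩
    · rw [Finset.card_insert_of_notMem ha.2, hcard]
    · intro j hj k hk hkt
      rw [Finset.mem_insert, not_or] at hkt
      rcases Finset.mem_insert.1 hj with rfl | hj
      · exact hamax k (Finset.mem_sdiff.2 ⟨hk, hkt.2⟩)
      · exact hmax j hj k hk hkt.2

/-- Two distinct points get the same colour under a `1 / m` fraction of all `m`-colourings. -/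
theorem mul_sum_ite_eq_card {ι : Type*} [Fintype ι] [DecidableEq ι] (m : ℕ) [NeZero m]
    {i k : ι} (hik : k ≠ i) :
    (m : ℝ) * ∑ f : ι → ZMod m, (if f k = f i then (1 : ℝ) else 0)
      = Fintype.card (ι → ZMod m) := by
  have hshift : ∀ a : ZMod m, ∑ f : ι → ZMod m, (if f k = f i then (1 : ℝ) else 0)
      = ∑ f : ι → ZMod m, (if f k - f i = a then (1 : ℝ) else 0) := by
    intro a
    rw [← Equiv.sum_comp (Equiv.addRight (Pi.single i (-a) : ι → ZMod m))
      (fun f : ι → ZMod m => if f k - f i = a then (1 : ℝ) else 0)]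
    refine Finset.sum_congr rfl fun f _ => ?_
    have : (f k = f i) ↔ (f k - (f i + -a) = a) := by
      constructor
      · intro h; rw [h]; ring
      · intro h; linear_combination h
    simp [Pi.single_eq_of_ne hik, this]
  have hsum : ∑ _a : ZMod m, ∑ f : ι → ZMod m, (if f k = f i then (1 : ℝ) else 0)
      = Fintype.card (ι → ZMod m) := by
    rw [Finset.sum_congr rfl fun a _ => hshift a, Finset.sum_comm]
    simp
  simpa [ZMod.card] using hsum

/-- Some `m`-colouring has at most the average total weight of monochromatic pairs. -/
theorem exists_coloring_mul_sum_le {ι : Type*} [Fintype ι] [DecidableEq ι] (m : ℕ) [NeZero m]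
    (W : ι → ι → ℝ) (hW : ∀ i k, 0 ≤ W i k) :
    ∃ f : ι → ZMod m,
      (m : ℝ) * ∑ i, ∑ k, (if k ≠ i ∧ f k = f i then W i k else 0) ≤ ∑ i, ∑ k, W i k := by
  by_contra! hcon
  have hlt : ∑ _f : ι → ZMod m, ∑ i, ∑ k, W i k < ∑ f : ι → ZMod m,
      (m : ℝ) * ∑ i, ∑ k, (if k ≠ i ∧ f k = f i then W i k else 0) :=
    Finset.sum_lt_sum_of_nonempty Finset.univ_nonempty fun f _ => hcon f
  refine absurd hlt (not_lt.2 ?_)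
  simp_rw [Finset.mul_sum]
  rw [Finset.sum_comm, Finset.sum_comm (s := (univ : Finset (ι → ZMod m)))]
  refine Finset.sum_le_sum fun i _ => ?_
  rw [Finset.sum_comm, Finset.sum_comm (s := (univ : Finset (ι → ZMod m)))]
  refine Finset.sum_le_sum fun k _ => ?_
  by_cases hik : k = i
  · simpa [hik] using mul_nonneg (pow_nonneg (Nat.cast_nonneg m) _) (hW i i)
  · have h := mul_sum_ite_eq_card m hik
    have : ∑ f : ι → ZMod m, (m : ℝ) * (if k ≠ i ∧ f k = f i then W i k else 0)
        = ((m : ℝ) * ∑ f : ι → ZMod m, (if f k = f i then (1 : ℝ) else 0)) * W i k := by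
      rw [Finset.mul_sum, Finset.sum_mul]
      refine Finset.sum_congr rfl fun f _ => ?_
      by_cases hf : f k = f i <;> simp [hik, hf]
    rw [this, h]
    simp

/-- If the nonnegative weights `W` have total at most `(2 * ε)⁻¹ * #ι`, then some set of
at least `ε / 4 * #ι` points receives inner weight less than one at each of its points. -/
theorem exists_finset_forall_sum_erase_lt_one {ι : Type*} [Fintype ι] [DecidableEq ι]
    (W : ι → ι → ℝ) (hW : ∀ i k, 0 ≤ W i k) {ε : ℝ} (hε : 0 < ε) (hε1 : ε ≤ 1)
    (hsum : ∑ i, ∑ k, W i k ≤ ε⁻¹ / 2 * Fintype.card ι) :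
    ∃ T : Finset ι, ε / 4 * Fintype.card ι ≤ T.card ∧
      ∀ i ∈ T, ∑ k ∈ T.erase i, W i k < 1 := by
  set m : ℕ := ⌈ε⁻¹⌉₊ with hm
  have hinv : 0 < ε⁻¹ := inv_pos.2 hε
  have hm0 : 0 < m := Nat.ceil_pos.2 hinv
  have : NeZero m := ⟨hm0.ne'⟩
  have hm0' : (0 : ℝ) < m := by exact_mod_cast hm0
  have hmlow : ε⁻¹ ≤ m := Nat.le_ceil _
  have hmup : (m : ℝ) ≤ 2 * ε⁻¹ := by
    have h1 : (m : ℝ) < ε⁻¹ + 1 := Nat.ceil_lt_add_one hinv.le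
    have h2 : 1 ≤ ε⁻¹ := (one_le_inv₀ hε).2 hε1
    linarith
  obtain ⟨f, hf⟩ := exists_coloring_mul_sum_le m W hW
  set S : ι → ℝ := fun i => ∑ k, (if k ≠ i ∧ f k = f i then W i k else 0) with hS
  have hS0 : ∀ i, 0 ≤ S i := fun i => Finset.sum_nonneg fun k _ => by
    split_ifs
    exacts [hW i k, le_rfl]
  have htotal : ∑ i, S i ≤ Fintype.card ι / 2 := by
    have h1 : ε⁻¹ * ∑ i, S i ≤ ε⁻¹ * (Fintype.card ι / 2) := by
      calc ε⁻¹ * ∑ i, S i ≤ m * ∑ i, S i :=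
            mul_le_mul_of_nonneg_right hmlow (Finset.sum_nonneg fun i _ => hS0 i)
        _ ≤ _ := hf
        _ ≤ _ := hsum
        _ = _ := by ring
    exact le_of_mul_le_mul_left h1 hinv
  set G : Finset ι := univ.filter fun i => S i < 1 with hG
  have hbad : ((univ.filter fun i => ¬ S i < 1).card : ℝ) ≤ Fintype.card ι / 2 := by
    refine le_trans ?_ htotal
    calc ((univ.filter fun i => ¬ S i < 1).card : ℝ)
        = ∑ _i ∈ univ.filter (fun i => ¬ S i < 1), (1 : ℝ) := by simp
      _ ≤ ∑ i ∈ univ.filter (fun i => ¬ S i < 1), S i :=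
          Finset.sum_le_sum fun i hi => not_lt.1 (Finset.mem_filter.1 hi).2
      _ ≤ ∑ i, S i :=
          Finset.sum_le_sum_of_subset_of_nonneg (Finset.filter_subset _ _) fun i _ _ => hS0 i
  have hgood : (Fintype.card ι : ℝ) / 2 ≤ G.card := by
    have h := Finset.card_filter_add_card_filter_not (s := (univ : Finset ι)) (fun i => S i < 1)
    have h' : (G.card : ℝ) + ((univ.filter fun i => ¬ S i < 1).card : ℝ) = Fintype.card ι := by
      exact_mod_cast h
    linarith
  obtain ⟨c, hc⟩ : ∃ c : ZMod m, (G.card : ℝ) / m ≤ (G.filter fun i => f i = c).card := by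
    by_contra! hcon
    have h1 : ∑ c : ZMod m, ((G.filter fun i => f i = c).card : ℝ)
        < ∑ _c : ZMod m, (G.card : ℝ) / m :=
      Finset.sum_lt_sum_of_nonempty Finset.univ_nonempty fun c _ => hcon c
    have h2 : ∑ c : ZMod m, ((G.filter fun i => f i = c).card : ℝ) = G.card := by
      exact_mod_cast (Finset.card_eq_sum_card_fiberwise (f := f) (s := G) (t := univ)
        (fun _ _ => Finset.mem_coe.2 (Finset.mem_univ _))).symm
    rw [h2] at h1
    simp only [Finset.sum_const, Finset.card_univ, ZMod.card, nsmul_eq_mul] at h1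
    rw [mul_div_cancel₀ _ hm0'.ne'] at h1
    exact lt_irrefl _ h1
  refine ⟨G.filter fun i => f i = c, ?_, ?_⟩
  · refine le_trans ?_ hc
    rw [le_div_iff₀ hm0']
    calc ε / 4 * Fintype.card ι * m ≤ ε / 4 * Fintype.card ι * (2 * ε⁻¹) := by gcongr
      _ = Fintype.card ι / 2 := by field_simp; ring
      _ ≤ _ := hgood
  · intro i hi
    rw [Finset.mem_filter, hG, Finset.mem_filter] at hi
    refine lt_of_le_of_lt ?_ hi.1.2
    rw [hS]
    simp only
    rw [← Finset.sum_filter]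
    refine Finset.sum_le_sum_of_subset_of_nonneg ?_ fun k _ _ => hW i k
    intro k hk
    rw [Finset.mem_erase, Finset.mem_filter] at hk
    simp [hk.1, hk.2.2, hi.2]

/-- there are `ε₀, c > 0` such that for every `0 < ε ≤ ε₀` and all `N` large
enough (depending on `ε`), every Ising instance on `N` variables of maximum degree at most
`d` admits a set `T` with `|T| ≥ c·ε·N` such that, with `D = ⌊(1/99)·ε⁻¹⌋`:
(1) every `i ∈ T` has at most `99·ε·d` neighbors inside `T`;
(2) every `i ∈ T` with a neighbor inside `T` has at least `D` variables `j ∉ T` with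
`|J i j| ≥ max_{k ∈ T} |J i k|`;
(3) one can choose, for each such `i`, a set `E i` of exactly `D` such variables (its
"strong edges") so that for every `i ∈ T`, the sum over neighbors `j ∉ T` of `i` of the
number of `k ∈ T` with `j ∈ E k` is at most `99·d`. -/
theorem stmt15 :
    ∃ ε₀ c : ℝ, 0 < ε₀ ∧ 0 < c ∧
      ∀ ε : ℝ, 0 < ε → ε ≤ ε₀ →
        ∃ N₀ : ℕ, ∀ N : ℕ, N₀ ≤ N →
          ∀ (d : ℕ) (h : Fin N → ℝ) (J : Fin N → Fin N → ℝ),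
            (∀ i j, J i j = J j i) → (∀ i, J i i = 0) →
            (∀ i, degreeJ J i ≤ d) →
            ∃ T : Finset (Fin N),
              c * ε * N ≤ T.card ∧
              (∀ i ∈ T,
                ((T.filter (fun j => j ≠ i ∧ J i j ≠ 0)).card : ℝ) ≤ 99 * ε * d) ∧
              (∀ i ∈ T, (∃ k ∈ T, k ≠ i ∧ J i k ≠ 0) →
                ⌊ε⁻¹ / 99⌋₊ ≤
                  (univ.filter (fun j => j ∉ T ∧ ∀ k ∈ T, |J i k| ≤ |J i j|)).card) ∧
              ∃ E : Fin N → Finset (Fin N),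
                (∀ i ∈ T, (∃ k ∈ T, k ≠ i ∧ J i k ≠ 0) →
                  (E i).card = ⌊ε⁻¹ / 99⌋₊ ∧
                    ∀ j ∈ E i, j ∉ T ∧ ∀ k ∈ T, |J i k| ≤ |J i j|) ∧
                (∀ i ∈ T, ¬(∃ k ∈ T, k ≠ i ∧ J i k ≠ 0) → E i = ∅) ∧
                ∀ i ∈ T,
                  ((∑ j ∈ univ.filter (fun j => j ∉ T ∧ j ≠ i ∧ J i j ≠ 0),
                      (T.filter (fun k => j ∈ E k)).card : ℕ) : ℝ) ≤ 99 * d := by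
  refine ⟨1, 1 / 4, one_pos, by norm_num, fun ε hε hε1 => ⟨⌊ε⁻¹ / 99⌋₊ + 1, ?_⟩⟩
  intro N hN d _ J hsymm hdiag hdeg
  have hinv : 0 < ε⁻¹ := inv_pos.2 hε
  set D : ℕ := ⌊ε⁻¹ / 99⌋₊ with hD
  have hDle : (D : ℝ) ≤ ε⁻¹ / 99 := Nat.floor_le (by positivity)
  set nb : Fin N → Finset (Fin N) := fun i => univ.filter fun j => j ≠ i ∧ J i j ≠ 0 with hnb
  have hnbcard : ∀ i, (nb i).card ≤ d := fun i => by
    have h := hdeg i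
    rwa [degreeJ, Set.ncard_eq_toFinset_card', Set.toFinset_ofPred] at h
  have hnbsymm : ∀ i j, j ∈ nb i ↔ i ∈ nb j := fun i j => by
    simp only [hnb, Finset.mem_filter, Finset.mem_univ, true_and, hsymm i j, ne_comm]
  rcases Nat.eq_zero_or_pos d with rfl | hd
  · have hnone : ∀ i k, ¬ (k ≠ i ∧ J i k ≠ 0) := fun i k hk => by
      have h0 : nb i = ∅ := Finset.card_eq_zero.1 (Nat.le_zero.1 (hnbcard i))
      have : k ∈ nb i := by simpa [hnb] using hk
      simp [h0] at this
    have hnone' : ∀ i, ¬ ∃ k ∈ (univ : Finset (Fin N)), k ≠ i ∧ J i k ≠ 0 :=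
      fun i ⟨k, _, hk⟩ => hnone i k hk
    refine ⟨univ, ?_, ?_, fun i _ h => absurd h (hnone' i), fun _ => ∅,
      fun i _ h => absurd h (hnone' i), fun _ _ _ => rfl, ?_⟩
    · rw [Finset.card_univ, Fintype.card_fin]
      have : (0 : ℝ) ≤ N := Nat.cast_nonneg N
      nlinarith
    · intro i _
      rw [Finset.filter_false_of_mem fun k _ => hnone i k]
      simp
    · simp
  have hd' : (0 : ℝ) < d := by exact_mod_cast hd
  have htop : ∀ i : Fin N, ∃ t ⊆ univ.erase i, t.card = D ∧
      ∀ j ∈ t, ∀ k ∈ univ.erase i, k ∉ t → |J i k| ≤ |J i j| := fun i =>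
    exists_subset_card_eq_forall_le _ (fun j => |J i j|) D (by
      rw [Finset.card_erase_of_mem (Finset.mem_univ i), Finset.card_univ, Fintype.card_fin]
      omega)
  choose E hEsub hEcard hEmax using htop
  set A : Fin N → Fin N → ℝ := fun i k => if k ∈ nb i then 1 else 0 with hA
  set B : Fin N → Fin N → ℝ := fun i k => if k ∈ E i then 1 else 0 with hB
  set C : Fin N → Fin N → ℝ := fun i k => ((nb i ∩ E k).card : ℝ) with hC
  have hA0 : ∀ i k, 0 ≤ A i k := fun i k => by simp only [hA]; split_ifs <;> norm_num
  have hB0 : ∀ i k, 0 ≤ B i k := fun i k => by simp only [hB]; split_ifs <;> norm_num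
  have hC0 : ∀ i k, 0 ≤ C i k := fun i k => Nat.cast_nonneg _
  have hAsum : ∑ i, ∑ k, A i k ≤ N * d := by
    calc ∑ i, ∑ k, A i k = ∑ i, ((nb i).card : ℝ) := by simp [hA]
      _ ≤ ∑ _i : Fin N, (d : ℝ) := Finset.sum_le_sum fun i _ => by exact_mod_cast hnbcard i
      _ = N * d := by simp
  have hBsum : ∑ i, ∑ k, B i k = N * D := by
    simp [hB, hEcard]
  have hCsum : ∑ i, ∑ k, C i k ≤ N * D * d := by
    have hrow : ∀ k, ∑ i, C i k ≤ D * d := fun k => by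
      calc ∑ i, C i k = ∑ i, ∑ j ∈ E k, (if j ∈ nb i then (1 : ℝ) else 0) := by
            refine Finset.sum_congr rfl fun i _ => ?_
            rw [Finset.sum_boole, Finset.filter_mem_eq_inter, Finset.inter_comm]
        _ = ∑ j ∈ E k, ((nb j).card : ℝ) := by
            rw [Finset.sum_comm]
            refine Finset.sum_congr rfl fun j _ => ?_
            rw [Finset.sum_congr rfl fun i _ => if_congr (hnbsymm i j) rfl rfl]
            simp
        _ ≤ ∑ _j ∈ E k, (d : ℝ) := Finset.sum_le_sum fun j _ => by exact_mod_cast hnbcard j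
        _ = D * d := by simp [hEcard]
    rw [Finset.sum_comm]
    calc ∑ k, ∑ i, C i k ≤ ∑ _k : Fin N, (D * d : ℝ) := Finset.sum_le_sum fun k _ => hrow k
      _ = N * D * d := by simp [mul_assoc]
  obtain ⟨T, hTcard, hT⟩ := exists_finset_forall_sum_erase_lt_one
    (fun i k => A i k / (99 * ε * d) + B i k + C i k / (98 * d))
    (fun i k => by have := hA0 i k; have := hB0 i k; have := hC0 i k; positivity) hε hε1 (by
      simp only [Finset.sum_add_distrib, ← Finset.sum_div, Fintype.card_fin]
      have h1 : (∑ i, ∑ k, A i k) / (99 * ε * d) ≤ N * (ε⁻¹ / 99) := by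
        rw [div_le_iff₀ (by positivity)]
        refine hAsum.trans (le_of_eq ?_)
        field_simp
      have h2 : (∑ i, ∑ k, C i k) / (98 * d) ≤ N * D := by
        rw [div_le_iff₀ (by positivity)]
        refine hCsum.trans ?_
        have : (0 : ℝ) ≤ N * D * d := by positivity
        nlinarith
      have h3 : (N : ℝ) * D ≤ N * (ε⁻¹ / 99) := by gcongr
      have h4 : (0 : ℝ) ≤ N * ε⁻¹ := by positivity
      rw [hBsum]
      linarith)
  rw [Fintype.card_fin] at hTcard
  simp only [Finset.sum_add_distrib, ← Finset.sum_div] at hT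
  have hApos : ∀ i, 0 ≤ (∑ k ∈ T.erase i, A i k) / (99 * ε * d) := fun i =>
    div_nonneg (Finset.sum_nonneg fun k _ => hA0 i k) (by positivity)
  have hBpos : ∀ i, 0 ≤ ∑ k ∈ T.erase i, B i k := fun i => Finset.sum_nonneg fun k _ => hB0 i k
  have hCpos : ∀ i, 0 ≤ (∑ k ∈ T.erase i, C i k) / (98 * d) := fun i =>
    div_nonneg (Finset.sum_nonneg fun k _ => hC0 i k) (by positivity)
  have hdisj : ∀ i ∈ T, ∀ j ∈ E i, j ∉ T := fun i hi j hj hjT => by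
    have h1 : B i j ≤ ∑ k ∈ T.erase i, B i k :=
      Finset.single_le_sum (fun k _ => hB0 i k)
        (Finset.mem_erase.2 ⟨(Finset.mem_erase.1 (hEsub i hj)).1, hjT⟩)
    have h2 : B i j = 1 := if_pos hj
    linarith [hT i hi, hApos i, hCpos i]
  have hstrong : ∀ i ∈ T, ∀ j ∈ E i, j ∉ T ∧ ∀ k ∈ T, |J i k| ≤ |J i j| :=
    fun i hi j hj => ⟨hdisj i hi j hj, fun k hk => by
      by_cases hki : k = i
      · rw [hki, hdiag, abs_zero]
        exact abs_nonneg _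
      · exact hEmax i j hj k (Finset.mem_erase.2 ⟨hki, Finset.mem_univ k⟩)
          fun hkE => hdisj i hi k hkE hk⟩
  refine ⟨T, ?_, ?_, ?_,
    fun i => if ∃ k ∈ T, k ≠ i ∧ J i k ≠ 0 then E i else ∅, ?_, ?_, ?_⟩
  · linarith
  · intro i hi
    have h1 : (∑ k ∈ T.erase i, A i k) / (99 * ε * d) < 1 := by
      linarith [hT i hi, hBpos i, hCpos i]
    rw [div_lt_one (by positivity)] at h1
    refine le_trans (le_of_eq ?_) h1.le
    rw [hA, Finset.sum_boole]
    congr 2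
    ext k
    simp only [hnb, Finset.mem_filter, Finset.mem_erase, Finset.mem_univ, true_and]
    tauto
  · intro i hi _
    rw [← hEcard i]
    exact Finset.card_le_card fun j hj =>
      Finset.mem_filter.2 ⟨Finset.mem_univ j, hstrong i hi j hj⟩
  · intro i hi h
    simp only [if_pos h]
    exact ⟨hEcard i, hstrong i hi⟩
  · intro i _ h
    exact if_neg h
  · intro i hi
    have h1 : (∑ k ∈ T.erase i, C i k) / (98 * d) < 1 := by
      linarith [hT i hi, hApos i, hBpos i]
    rw [div_lt_one (by positivity)] at h1
    have h2 : C i i ≤ d :=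
      Nat.cast_le.2 ((Finset.card_le_card Finset.inter_subset_left).trans (hnbcard i))
    have h3 : ∑ k ∈ T, C i k ≤ 99 * d := by
      rw [← Finset.add_sum_erase T _ hi]
      linarith
    refine le_trans ?_ h3
    have h4 : ∑ k ∈ T, C i k = ((∑ j ∈ nb i, (T.filter fun k => j ∈ E k).card : ℕ) : ℝ) := by
      have : ∑ j ∈ nb i, (T.filter fun k => j ∈ E k).card = ∑ k ∈ T, (nb i ∩ E k).card := by
        simp_rw [Finset.card_filter]
        rw [Finset.sum_comm]
        refine Finset.sum_congr rfl fun k _ => ?_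
        rw [← Finset.card_filter, Finset.filter_mem_eq_inter]
      rw [this]
      push_cast
      rfl
    rw [h4, Nat.cast_le]
    refine (Finset.sum_le_sum fun j _ => Finset.card_le_card ?_).trans
      (Finset.sum_le_sum_of_subset fun j hj => ?_)
    · intro k hk
      rw [Finset.mem_filter] at hk ⊢
      refine ⟨hk.1, ?_⟩
      have hk2 : j ∈ if ∃ l ∈ T, l ≠ k ∧ J k l ≠ 0 then E k else ∅ := hk.2
      split_ifs at hk2
      · exact hk2
      · simp at hk2
    · simp only [hnb, Finset.mem_filter, Finset.mem_univ, true_and] at hj ⊢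
      exact hj.2
end

section
/- There exist constants κ > 0 and λ > 0 such that for every integer d ≥ 1 and every N, every Ising instance on N variables whose graph has maximum degree at most d has at most 2^{N·(1 − κ·log₂(λ·d)/d)} local minima. -/
open Finset

open scoped BigOperators Finset

namespace IsingCount

variable {ι : Type*} [DecidableEq ι]

section Holder

theorem prod_rpow_le_arith {α : Type*} (I : Finset α) {k : ℕ} (hk : 0 < k) (hI : #I ≤ k)
    (x : α → ℝ) (hx : ∀ i ∈ I, 0 ≤ x i) :
    ∏ i ∈ I, x i ^ (1 / k : ℝ) ≤ ∑ i ∈ I, (1 / k : ℝ) * x i + (1 - #I / k) := by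
  have hk' : (0 : ℝ) < k := by exact_mod_cast hk
  have hI' : (#I : ℝ) ≤ k := by exact_mod_cast hI
  have h := Real.geom_mean_le_arith_mean_weighted (insertNone I)
    (fun o => o.elim (1 - #I / k : ℝ) fun _ => 1 / k) (fun o => o.elim 1 x) ?_ ?_ ?_
  · simp only [prod_insertNone, sum_insertNone, Option.elim, Real.one_rpow, one_mul, mul_one] at h
    linarith
  · intro o ho
    cases o with
    | none => simpa using div_le_one_of_le₀ hI' hk'.le
    | some i => simp
  · simp only [sum_insertNone, Option.elim, sum_const, nsmul_eq_mul]
    field_simp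
    ring
  · intro o ho
    cases o with
    | none => simp
    | some i => exact hx i (by simpa using ho)

theorem two_point_holder {α : Type*} (I : Finset α) {k : ℕ} (hk : 0 < k) (hI : #I ≤ k)
    (a b : α → ℝ) (ha : ∀ i, 0 ≤ a i) (hb : ∀ i, 0 ≤ b i) :
    (∏ i ∈ I, a i ^ (1 / k : ℝ) + ∏ i ∈ I, b i ^ (1 / k : ℝ)) / 2 ≤
      ∏ i ∈ I, ((a i + b i) / 2) ^ (1 / k : ℝ) := by
  have hk' : (0 : ℝ) < k := by exact_mod_cast hk
  have hk1 : (1 / k : ℝ) ≠ 0 := by positivity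
  by_cases hz : ∃ i ∈ I, a i + b i = 0
  · obtain ⟨i, hi, h0⟩ := hz
    have hai : a i = 0 := by linarith [ha i, hb i]
    have hbi : b i = 0 := by linarith [ha i, hb i]
    rw [prod_eq_zero hi (by rw [hai, Real.zero_rpow hk1]),
      prod_eq_zero hi (by rw [hbi, Real.zero_rpow hk1])]
    simp only [add_zero, zero_div]
    exact prod_nonneg fun j _ => Real.rpow_nonneg (by linarith [ha j, hb j]) _
  push Not at hz
  have hc : ∀ i ∈ I, 0 < (a i + b i) / 2 := fun i hi =>
    half_pos (lt_of_le_of_ne (add_nonneg (ha i) (hb i)) (hz i hi).symm)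
  have key : ∀ x : α → ℝ, (∀ i, 0 ≤ x i) → ∏ i ∈ I, x i ^ (1 / k : ℝ) =
      (∏ i ∈ I, (x i / ((a i + b i) / 2)) ^ (1 / k : ℝ)) *
        ∏ i ∈ I, ((a i + b i) / 2) ^ (1 / k : ℝ) := by
    intro x hx
    rw [← prod_mul_distrib]
    refine prod_congr rfl fun i hi => ?_
    rw [← Real.mul_rpow (div_nonneg (hx i) (hc i hi).le) (hc i hi).le,
      div_mul_cancel₀ _ (hc i hi).ne']
  rw [key a ha, key b hb, ← add_mul, mul_div_right_comm]
  refine mul_le_of_le_one_left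
    (prod_nonneg fun i hi => Real.rpow_nonneg (hc i hi).le _) ?_
  have h1 := prod_rpow_le_arith I hk hI (fun i => a i / ((a i + b i) / 2))
    fun i hi => div_nonneg (ha i) (hc i hi).le
  have h2 := prod_rpow_le_arith I hk hI (fun i => b i / ((a i + b i) / 2))
    fun i hi => div_nonneg (hb i) (hc i hi).le
  have h3 : ∑ i ∈ I, (1 / k : ℝ) * (a i / ((a i + b i) / 2)) +
      ∑ i ∈ I, (1 / k : ℝ) * (b i / ((a i + b i) / 2)) = 2 * (#I / k) := by
    rw [← sum_add_distrib, sum_congr rfl (g := fun _ => (2 / k : ℝ)), sum_const, nsmul_eq_mul]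
    · ring
    · intro i hi
      have := (hc i hi).ne'
      have h0 := hz i hi
      field_simp
  linarith

/-- Average of `F` over the two values of the coordinate `v`. -/
noncomputable def avg (v : ι) (F : (ι → Bool) → ℝ) (S : ι → Bool) : ℝ :=
  (F S + F (Function.update S v (!S v))) / 2

theorem expect_avg [Fintype ι] (v : ι) (F : (ι → Bool) → ℝ) : 𝔼 S, avg v F S = 𝔼 S, F S := by
  have hinv : Function.Involutive fun S : ι → Bool => Function.update S v (!S v) := by
    intro S
    simp
  have h : 𝔼 S, F (Function.update S v (!S v)) = 𝔼 S, F S :=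
    Fintype.expect_equiv hinv.toPerm _ _ fun S => rfl
  simp only [avg]
  rw [← Finset.expect_div, expect_add_distrib, h]
  ring

theorem dependsOn_avg {F : (ι → Bool) → ℝ} {A : Finset ι} (hF : DependsOn F (A : Set ι)) (v : ι) :
    DependsOn (avg v F) (A.erase v : Finset ι) := by
  have hflip : ∀ S : ι → Bool, avg v F S =
      (F (Function.update S v true) + F (Function.update S v false)) / 2 := by
    intro S
    have hS : S = Function.update S v (S v) := by simp
    cases h : S v
    · rw [h] at hS
      rw [avg, h, Bool.not_false, add_comm]
      conv_lhs => rw [hS]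
      simp
    · rw [h] at hS
      rw [avg, h, Bool.not_true]
      conv_lhs => rw [hS]
      simp
  intro S S' h
  rw [hflip, hflip]
  congr 2 <;>
  · refine hF fun i hi => ?_
    by_cases hiv : i = v
    · subst hiv; simp
    · simpa [hiv] using h i (by simpa [hiv] using hi)

theorem avg_of_notMem {F : (ι → Bool) → ℝ} {A : Finset ι} (hF : DependsOn F (A : Set ι)) {v : ι}
    (hv : v ∉ A) (S : ι → Bool) : F (Function.update S v (!S v)) = F S :=
  hF fun i hi => Function.update_of_ne (by rintro rfl; exact hv hi) _ _

/-- **Finner's inequality** on the Boolean cube with uniform exponents. -/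
theorem expect_prod_rpow_le [Fintype ι] {α : Type*} (T : Finset α) {k : ℕ} (hk : 0 < k) (U : Finset ι) :
    ∀ (F : α → (ι → Bool) → ℝ) (A : α → Finset ι), (∀ i S, 0 ≤ F i S) →
      (∀ i, DependsOn (F i) (A i : Set ι)) → (∀ i, A i ⊆ U) →
      (∀ v, #{i ∈ T | v ∈ A i} ≤ k) →
      𝔼 S, ∏ i ∈ T, F i S ^ (1 / k : ℝ) ≤ ∏ i ∈ T, (𝔼 S, F i S) ^ (1 / k : ℝ) := by
  induction U using Finset.induction_on with
  | empty =>
    intro F A _ hdep hA _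
    have hconst : ∀ i S, F i S = F i fun _ => true := fun i S =>
      hdep i fun j hj => absurd (hA i hj) (notMem_empty j)
    simp only [fun i S => hconst i S]
    simp
  | insert v U _ ih =>
    intro F A hF hdep hA hT
    rw [← expect_avg v]
    simp only [← expect_avg v (F _)]
    refine le_trans ?_ (ih (fun i => avg v (F i)) (fun i => (A i).erase v)
      (fun i S => div_nonneg (add_nonneg (hF _ _) (hF _ _)) two_pos.le) (fun i => dependsOn_avg (hdep i) v)
      (fun i => by simpa using erase_subset_erase v (hA i) |>.trans (erase_insert_subset v U))
      fun w => (card_le_card fun i hi => ?_).trans (hT w))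
    · refine expect_le_expect fun S _ => ?_
      have hsplit : ∀ G : α → ℝ, ∏ i ∈ T, G i =
          (∏ i ∈ T with v ∈ A i, G i) * ∏ i ∈ T with v ∉ A i, G i :=
        fun G => (prod_filter_mul_prod_filter_not T _ G).symm
      have h1 : ∏ i ∈ T with v ∉ A i, F i (Function.update S v (!S v)) ^ (1 / k : ℝ) =
          ∏ i ∈ T with v ∉ A i, F i S ^ (1 / k : ℝ) :=
        prod_congr rfl fun i hi => by rw [avg_of_notMem (hdep i) (mem_filter.1 hi).2]
      have h2 : ∏ i ∈ T with v ∉ A i, avg v (F i) S ^ (1 / k : ℝ) =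
          ∏ i ∈ T with v ∉ A i, F i S ^ (1 / k : ℝ) :=
        prod_congr rfl fun i hi => by
          rw [avg, avg_of_notMem (hdep i) (mem_filter.1 hi).2, add_self_div_two]
      rw [avg, hsplit fun i => F i S ^ (1 / k : ℝ),
        hsplit fun i => F i (Function.update S v (!S v)) ^ (1 / k : ℝ),
        hsplit fun i => avg v (F i) S ^ (1 / k : ℝ), h1, h2, ← add_mul, mul_div_right_comm]
      exact mul_le_mul_of_nonneg_right
        (two_point_holder _ hk (hT v) _ _ (fun i => hF i _) fun i => hF i _)
        (prod_nonneg fun i _ => Real.rpow_nonneg (hF _ _) _)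
    · simp only [mem_filter, mem_erase] at hi ⊢
      exact ⟨hi.1, hi.2.2⟩

end Holder

section AntiConcentration

theorem card_mul_two_pow_eq_sum [Fintype ι] (B : Finset (ι → Bool)) (M : Finset ι) :
    #B * 2 ^ #M = ∑ S' : ι → Bool, #{S ∈ B | ∀ j ∉ M, S j = S' j} := by
  have h := sum_card_bipartiteAbove_eq_sum_card_bipartiteBelow (s := B)
    (t := (univ : Finset (ι → Bool))) fun S S' => ∀ j ∉ M, S j = S' j
  simp only [bipartiteBelow] at h
  rw [← h, sum_const_nat]
  intro S _
  have : bipartiteAbove (fun S S' => ∀ j ∉ M, S j = S' j) univ S =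
      Fintype.piFinset fun j => if j ∈ M then univ else {S j} := by
    ext S'
    simp only [bipartiteAbove, mem_filter, mem_univ, true_and, Fintype.mem_piFinset]
    refine forall_congr' fun j => ?_
    by_cases hj : j ∈ M <;> simp [hj, @eq_comm _ (S j)]
  rw [this, Fintype.card_piFinset]
  simp only [apply_ite Finset.card, prod_ite, card_singleton, prod_const, card_univ,
    Fintype.card_bool, one_pow, mul_one]
  simp

/-- The real value of a spin. -/
def spin (b : Bool) : ℝ := if b then 1 else -1

/-- The affine function of the spins with offset `c` and weights `w`. -/
noncomputable def field [Fintype ι] (c : ℝ) (w : ι → ℝ) (S : ι → Bool) : ℝ := c + ∑ j, w j * spin (S j)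

/-- **Littlewood–Offord inequality** (Erdős). -/
theorem littlewood_offord [Fintype ι] {M : Finset ι} {c a : ℝ} {w : ι → ℝ}
    (hw : ∀ j ∈ M, a ≤ |w j|) (B : Finset (ι → Bool))
    (hagree : ∀ S ∈ B, ∀ S' ∈ B, ∀ j ∉ M, S j = S' j)
    (hclose : ∀ S ∈ B, ∀ S' ∈ B, field c w S' - field c w S < 2 * a) :
    #B ≤ (#M).choose (#M / 2) := by
  classical
  let P : (ι → Bool) → Finset M := fun S => {j | S j = decide (0 < w j)}
  have hP : ∀ S (j : M), j ∈ P S ↔ S j = decide (0 < w j) := fun S j => by simp [P]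
  have hinj : Set.InjOn P B := by
    intro S hS S' hS' h
    ext j
    by_cases hj : j ∈ M
    · have h1 := hP S ⟨j, hj⟩
      have h2 := hP S' ⟨j, hj⟩
      rw [h, h2] at h1
      cases hs : S j <;> cases hs' : S' j <;> cases hd : decide (0 < w j) <;> simp_all
    · exact hagree S hS S' hS' j hj
  rw [← card_image_of_injOn hinj]
  have hanti : IsAntichain (· ⊆ ·) ((B.image P : Finset (Finset M)) : Set (Finset M)) := by
    intro X hX Y hY hne hsub
    simp only [coe_image, Set.mem_image, mem_coe] at hX hY
    obtain ⟨S, hS, rfl⟩ := hX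
    obtain ⟨S', hS', rfl⟩ := hY
    obtain ⟨⟨j₀, hj₀⟩, hmem, hnmem⟩ := exists_of_ssubset (hsub.ssubset_of_ne hne)
    refine (hclose S hS S' hS').not_ge ?_
    have hterm : ∀ j ∈ M, S j ≠ S' j → w j * spin (S' j) - w j * spin (S j) = 2 * |w j| := by
      intro j hj hne
      have h1 := hP S ⟨j, hj⟩
      have h2 := hP S' ⟨j, hj⟩
      have h3 := @hsub ⟨j, hj⟩
      rw [h1, h2] at h3
      rcases lt_or_ge 0 (w j) with h0 | h0
      · rw [abs_of_pos h0]
        cases hs : S j <;> cases hs' : S' j <;> (simp_all [spin]; try ring)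
      · rw [abs_of_nonpos h0]
        have : ¬ 0 < w j := not_lt.2 h0
        cases hs : S j <;> cases hs' : S' j <;> (simp_all [spin]; try ring)
    have hnn : ∀ j, 0 ≤ w j * spin (S' j) - w j * spin (S j) := by
      intro j
      by_cases heq : S j = S' j
      · simp [heq]
      · rw [hterm j (by by_contra hj; exact heq (hagree S hS S' hS' j hj)) heq]
        positivity
    have hsum : field c w S' - field c w S = ∑ j, (w j * spin (S' j) - w j * spin (S j)) := by
      rw [sum_sub_distrib]; simp [field]
    rw [hsum]
    refine le_trans ?_ (single_le_sum (fun j _ => hnn j) (mem_univ j₀))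
    rw [hterm j₀ hj₀ fun heq => hnmem ((hP S _).2 (heq ▸ (hP S' _).1 hmem))]
    linarith [hw j₀ hj₀]
  simpa using hanti.sperner

theorem card_field_lt_mul_le [Fintype ι] {M : Finset ι} {c a : ℝ} {w : ι → ℝ} (ha : 0 < a)
    (hw : ∀ j ∈ M, a ≤ |w j|) (k : ℕ) :
    #{S | |field c w S| < k * a} * 2 ^ #M ≤
      2 ^ Fintype.card ι * (k * (#M).choose (#M / 2)) := by
  classical
  rw [card_mul_two_pow_eq_sum]
  refine (sum_le_card_nsmul univ _ (k * (#M).choose (#M / 2)) fun S' _ => ?_).trans (by simp)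
  set B : Finset (ι → Bool) :=
    {S ∈ ({S | |field c w S| < k * a} : Finset (ι → Bool)) | ∀ j ∉ M, S j = S' j} with hB
  let t : (ι → Bool) → ℕ := fun S => ⌊(field c w S + k * a) / (2 * a)⌋₊
  have hpos : ∀ S ∈ B, 0 ≤ (field c w S + k * a) / (2 * a) := by
    intro S hS
    simp only [hB, mem_filter, mem_univ, true_and, abs_lt] at hS
    exact div_nonneg (by linarith [hS.1.1]) (by linarith)
  have hmaps : ∀ S ∈ B, t S ∈ range k := by
    intro S hS
    rw [mem_range, Nat.floor_lt (hpos S hS), div_lt_iff₀ (by linarith)]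
    simp only [hB, mem_filter, mem_univ, true_and, abs_lt] at hS
    linarith [hS.1.2]
  have h := card_le_mul_card_image_of_maps_to (s := B) (t := range k) hmaps
    ((#M).choose (#M / 2)) fun n _ => ?_
  · rwa [card_range, mul_comm] at h
  · refine littlewood_offord (c := c) hw _ (fun S hS S₂ hS₂ j hj => ?_) fun S hS S₂ hS₂ => ?_
    · simp only [hB, mem_filter] at hS hS₂
      rw [hS.1.2 j hj, hS₂.1.2 j hj]
    · rw [mem_filter] at hS hS₂
      have h1 := Nat.floor_le (hpos S hS.1)
      have h2 := Nat.lt_floor_add_one ((field c w S₂ + k * a) / (2 * a))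
      have h3 : ⌊(field c w S + k * a) / (2 * a)⌋₊ = n := hS.2
      have h4 : ⌊(field c w S₂ + k * a) / (2 * a)⌋₊ = n := hS₂.2
      rw [h3, le_div_iff₀ (by linarith)] at h1
      rw [h4, div_lt_iff₀ (by linarith)] at h2
      linarith

theorem centralBinom_sq_mul_le (n : ℕ) : n.centralBinom ^ 2 * (2 * n + 1) ≤ 16 ^ n := by
  induction n with
  | zero => simp
  | succ n ih =>
    have h := Nat.succ_mul_centralBinom_succ n
    have h2 : (n + 1) ^ 2 * ((n + 1).centralBinom ^ 2 * (2 * (n + 1) + 1)) ≤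
        (n + 1) ^ 2 * 16 ^ (n + 1) := by
      calc (n + 1) ^ 2 * ((n + 1).centralBinom ^ 2 * (2 * (n + 1) + 1))
          = ((n + 1) * (n + 1).centralBinom) ^ 2 * (2 * n + 3) := by ring
        _ = (n.centralBinom ^ 2 * (2 * n + 1)) * (4 * ((2 * n + 1) * (2 * n + 3))) := by
            rw [h]; ring
        _ ≤ 16 ^ n * (16 * (n + 1) ^ 2) := Nat.mul_le_mul ih (by nlinarith)
        _ = (n + 1) ^ 2 * 16 ^ (n + 1) := by ring
    exact Nat.le_of_mul_le_mul_left h2 (by positivity)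

theorem mul_choose_half_mul_le (k : ℕ) (hk : 0 < k) :
    k * (16 ^ k).choose (16 ^ k / 2) * 2 ^ k ≤ 2 ^ 16 ^ k := by
  obtain ⟨n, hn⟩ : ∃ n, 16 ^ k = 2 * n :=
    (dvd_pow (by norm_num : (2 : ℕ) ∣ 16) hk.ne')
  rw [hn, Nat.mul_div_cancel_left n two_pos, ← Nat.centralBinom_eq_two_mul_choose]
  refine (Nat.pow_le_pow_iff_left two_ne_zero).1 ?_
  have h := centralBinom_sq_mul_le n
  have hk2 : k ≤ 2 ^ k := Nat.lt_two_pow_self.le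
  have h16 : (16 : ℕ) ^ k = (2 ^ k) ^ 2 * (2 ^ k) ^ 2 := by
    rw [← pow_add, ← pow_mul, show (16 : ℕ) = 2 ^ 4 by norm_num, ← pow_mul]
    congr 1; ring
  calc (k * n.centralBinom * 2 ^ k) ^ 2 = n.centralBinom ^ 2 * (k ^ 2 * (2 ^ k) ^ 2) := by ring
    _ ≤ n.centralBinom ^ 2 * ((2 ^ k) ^ 2 * (2 ^ k) ^ 2) := by gcongr
    _ = n.centralBinom ^ 2 * (2 * n) := by rw [← h16, hn]
    _ ≤ n.centralBinom ^ 2 * (2 * n + 1) := by gcongr; omega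
    _ ≤ 16 ^ n := h
    _ = (2 ^ (2 * n)) ^ 2 := by
      rw [show (16 : ℕ) = 2 ^ 4 by norm_num, ← pow_mul, ← pow_mul]; congr 1; ring

end AntiConcentration

section SparseSet

theorem sum_subset_weight [Fintype ι] (p : ℝ) (A : Finset ι) :
    ∑ T : Finset ι, p ^ #T * (1 - p) ^ #Tᶜ * (if A ⊆ T then 1 else 0) = p ^ #A := by
  have h := Fintype.prod_add (fun _ : ι => p) fun i => if i ∈ A then 0 else 1 - p
  have hl : ∏ i : ι, (p + if i ∈ A then 0 else 1 - p) = p ^ #A := by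
    rw [← prod_const, ← prod_subset (subset_univ A)]
    · exact prod_congr rfl fun i hi => by simp [hi]
    · intro i _ hi
      simp [hi]
  rw [← hl, h]
  refine sum_congr rfl fun T _ => ?_
  rw [prod_const, mul_assoc]
  congr 1
  split_ifs with hA
  · rw [mul_one, ← prod_const]
    refine prod_congr rfl fun i hi => ?_
    rw [if_neg fun hiA => (mem_compl.1 hi) (hA hiA)]
  · obtain ⟨i, hiA, hiT⟩ := not_subset.1 hA
    have hz : ∏ j ∈ Tᶜ, (if j ∈ A then 0 else 1 - p) = 0 :=
      prod_eq_zero (mem_compl.2 hiT) (if_pos hiA)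
    rw [mul_zero, hz]

/-- Random deletion: a set of density about `p` meeting each neighbourhood in at most `k` points
and independent with respect to the sparse digraph `M`. -/
theorem exists_sparse_set [Fintype ι] (nb M : ι → Finset ι) (hsymm : ∀ i j, j ∈ nb i → i ∈ nb j)
    {D m k : ℕ} (hD : ∀ i, #(nb i) ≤ D) (hM : ∀ i, #(M i) ≤ m) (hMi : ∀ i, i ∉ M i)
    {p : ℝ} (hp0 : 0 ≤ p) (hp1 : p ≤ 1) (hpm : m * p ≤ 1 / 4)
    (hpk : D * D.choose k * p ^ k ≤ 1 / 4) :
    ∃ T : Finset ι, (∀ j, #{i ∈ T | i ∈ nb j} ≤ k) ∧ (∀ i ∈ T, ∀ j ∈ M i, j ∉ T) ∧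
      p * Fintype.card ι / 2 ≤ #T := by
  let W : Finset ι → ℝ := fun T => p ^ #T * (1 - p) ^ #Tᶜ
  have hW : ∀ T, 0 ≤ W T := fun T => by
    have : 0 ≤ 1 - p := by linarith
    positivity
  have hWA : ∀ A : Finset ι, ∑ T, W T * (if A ⊆ T then 1 else 0) = p ^ #A := sum_subset_weight p
  have hW1 : ∑ T, W T = 1 := by simpa using hWA ∅
  have hWcard : ∑ T, W T * #T = p * Fintype.card ι := by
    have : ∀ T : Finset ι, W T * #T = ∑ i, W T * (if {i} ⊆ T then 1 else 0) := by
      intro T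
      rw [← mul_sum]
      simp
    rw [sum_congr rfl fun T _ => this T, sum_comm, sum_congr rfl fun i _ => hWA {i}]
    simp [mul_comm]
  let good : Finset ι → Finset ι := fun T =>
    {i ∈ T | (∀ j ∈ M i, j ∉ T) ∧ ∀ j ∈ nb i, #{l ∈ T | l ∈ nb j} ≤ k}
  let Y : Finset ι → ι → ℝ := fun T i =>
    ∑ j ∈ M i, (if {i, j} ⊆ T then 1 else 0) +
      ∑ j ∈ nb i, ∑ A ∈ powersetCard k ((nb j).erase i), (if insert i A ⊆ T then 1 else 0)
  have hYE : ∀ i, ∑ T, W T * Y T i ≤ p / 2 := by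
    intro i
    have hind : ∑ T, W T * Y T i = ∑ j ∈ M i, p ^ #({i, j} : Finset ι) +
        ∑ j ∈ nb i, ∑ A ∈ powersetCard k ((nb j).erase i), p ^ #(insert i A) := by
      simp only [Y, mul_add, mul_sum, sum_add_distrib]
      rw [sum_comm, sum_congr rfl fun j _ => hWA {i, j}, sum_comm]
      congr 1
      refine sum_congr rfl fun j _ => ?_
      rw [sum_comm]
      exact sum_congr rfl fun A _ => hWA (insert i A)
    have h1 : ∑ j ∈ M i, p ^ #({i, j} : Finset ι) ≤ p * (1 / 4) := by
      calc ∑ j ∈ M i, p ^ #({i, j} : Finset ι) = ∑ j ∈ M i, p ^ 2 :=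
            sum_congr rfl fun j hj => by
              rw [card_pair (by rintro rfl; exact hMi _ hj)]
        _ = #(M i) * p ^ 2 := by simp
        _ ≤ m * p ^ 2 := by gcongr; exact hM i
        _ = p * (m * p) := by ring
        _ ≤ p * (1 / 4) := by gcongr
    have h2 : ∑ j ∈ nb i, ∑ A ∈ powersetCard k ((nb j).erase i), p ^ #(insert i A) ≤
        p * (1 / 4) := by
      calc ∑ j ∈ nb i, ∑ A ∈ powersetCard k ((nb j).erase i), p ^ #(insert i A)
          = ∑ j ∈ nb i, ∑ A ∈ powersetCard k ((nb j).erase i), p ^ (k + 1) :=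
            sum_congr rfl fun j _ => sum_congr rfl fun A hA => by
              rw [mem_powersetCard] at hA
              rw [card_insert_of_notMem fun hi => notMem_erase i _ (hA.1 hi), hA.2]
        _ = ∑ j ∈ nb i, (#((nb j).erase i)).choose k * p ^ (k + 1) := by simp
        _ ≤ ∑ j ∈ nb i, D.choose k * p ^ (k + 1) := by
            refine sum_le_sum fun j _ => ?_
            gcongr
            exact (card_le_card (erase_subset _ _)).trans (hD j)
        _ = #(nb i) * (D.choose k * p ^ (k + 1)) := by simp
        _ ≤ D * (D.choose k * p ^ (k + 1)) := by gcongr; exact hD i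
        _ = p * (D * D.choose k * p ^ k) := by ring
        _ ≤ p * (1 / 4) := by gcongr
    rw [hind]
    linarith
  have hY : ∀ T, (#T : ℝ) ≤ #(good T) + ∑ i, Y T i := by
    intro T
    have hnn1 : ∀ i, 0 ≤ ∑ j ∈ M i, (if {i, j} ⊆ T then 1 else 0 : ℝ) := fun i =>
      sum_nonneg fun j _ => by split_ifs <;> norm_num
    have hnn2 : ∀ i j, 0 ≤ ∑ A ∈ powersetCard k ((nb j).erase i),
        (if insert i A ⊆ T then 1 else 0 : ℝ) := fun i j =>
      sum_nonneg fun A _ => by split_ifs <;> norm_num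
    have hcard : ∀ s : Finset ι, (#s : ℝ) = ∑ i, if i ∈ s then 1 else 0 := fun s => by simp
    rw [hcard T, hcard (good T), ← sum_add_distrib]
    refine sum_le_sum fun i _ => ?_
    have hYi : 0 ≤ Y T i := add_nonneg (hnn1 i) (sum_nonneg fun j _ => hnn2 i j)
    by_cases hiT : i ∈ T
    swap
    · rw [if_neg hiT]
      split_ifs <;> linarith
    by_cases hig : i ∈ good T
    · rw [if_pos hiT, if_pos hig]
      linarith
    rw [if_pos hiT, if_neg hig, zero_add]
    have hbad : ¬ ((∀ j ∈ M i, j ∉ T) ∧ ∀ j ∈ nb i, #{l ∈ T | l ∈ nb j} ≤ k) := fun h =>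
      hig (mem_filter.2 ⟨hiT, h⟩)
    by_cases hc : ∀ j ∈ M i, j ∉ T
    · have : ¬ ∀ j ∈ nb i, #{l ∈ T | l ∈ nb j} ≤ k := fun h => hbad ⟨hc, h⟩
      push Not at this
      obtain ⟨j, hj, hlt⟩ := this
      have hmem : i ∈ ({l ∈ T | l ∈ nb j} : Finset ι) := mem_filter.2 ⟨hiT, hsymm i j hj⟩
      obtain ⟨A, hA, hAk⟩ := exists_subset_card_eq
        (s := ({l ∈ T | l ∈ nb j} : Finset ι).erase i) (n := k)
        (by rw [card_erase_of_mem hmem]; omega)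
      have hAT : insert i A ⊆ T := by
        refine insert_subset hiT fun l hl => ?_
        exact (mem_filter.1 (mem_of_mem_erase (hA hl))).1
      have hAmem : A ∈ powersetCard k ((nb j).erase i) := by
        refine mem_powersetCard.2 ⟨fun l hl => ?_, hAk⟩
        have := mem_erase.1 (hA hl)
        exact mem_erase.2 ⟨this.1, (mem_filter.1 this.2).2⟩
      have h1 : (1 : ℝ) ≤ ∑ A ∈ powersetCard k ((nb j).erase i),
          (if insert i A ⊆ T then 1 else 0 : ℝ) := by
        refine le_trans ?_ (single_le_sum (fun A _ => ?_) hAmem)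
        · rw [if_pos hAT]
        · split_ifs <;> norm_num
      have h2 := single_le_sum (fun j _ => hnn2 i j) hj
      have h3 := hnn1 i
      simp only [Y]
      linarith
    · push Not at hc
      obtain ⟨j, hj, hjT⟩ := hc
      have h1 : (1 : ℝ) ≤ ∑ j ∈ M i, (if {i, j} ⊆ T then 1 else 0 : ℝ) := by
        refine le_trans ?_ (single_le_sum (fun j _ => ?_) hj)
        · rw [if_pos]
          simp [insert_subset_iff, hiT, hjT]
        · split_ifs <;> norm_num
      have h2 := sum_nonneg fun j (_ : j ∈ nb i) => hnn2 i j
      simp only [Y]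
      linarith
  obtain ⟨T₀, -, hmax⟩ := exists_max_image univ (fun T => #(good T)) univ_nonempty
  refine ⟨good T₀, fun j => ?_, fun i hi j hj hjT => ?_, ?_⟩
  · by_contra! hlt
    obtain ⟨i, hi⟩ := card_pos.1 (lt_of_le_of_lt (Nat.zero_le k) hlt)
    rw [mem_filter] at hi
    have h1 := (mem_filter.1 hi.1).2.2 j (hsymm j i hi.2)
    refine absurd (h1.trans_lt hlt) (not_lt.2 (card_le_card ?_))
    exact filter_subset_filter _ (filter_subset _ _)
  · exact (mem_filter.1 hi).2.1 j hj (mem_filter.1 hjT).1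
  · have h1 : ∑ T, W T * #T ≤ ∑ T, (W T * #(good T₀) + ∑ i, W T * Y T i) := by
      refine sum_le_sum fun T _ => ?_
      rw [← mul_sum, ← mul_add]
      refine mul_le_mul_of_nonneg_left ((hY T).trans ?_) (hW T)
      have : (#(good T) : ℝ) ≤ #(good T₀) := by exact_mod_cast hmax T (mem_univ T)
      linarith
    rw [hWcard, sum_add_distrib, ← sum_mul, hW1, one_mul, sum_comm] at h1
    have h2 : ∑ i, ∑ T, W T * Y T i ≤ ∑ _i : ι, p / 2 := sum_le_sum fun i _ => hYE i
    rw [sum_const, card_univ, nsmul_eq_mul] at h2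
    linarith

theorem exists_top_subset (s : Finset ι) (f : ι → ℝ) (m : ℕ) :
    ∃ M ⊆ s, #M ≤ m ∧ (M = s ∨ #M = m) ∧ ∀ j ∈ M, ∀ l ∈ s \ M, f l ≤ f j := by
  induction m with
  | zero => exact ⟨∅, by simp⟩
  | succ m ih =>
    obtain ⟨M, hMs, hcard, hor, htop⟩ := ih
    by_cases hM : M = s
    · exact ⟨M, hMs, by omega, Or.inl hM, htop⟩
    have hne : (s \ M).Nonempty := sdiff_nonempty.2 fun h => hM (hMs.antisymm h)
    obtain ⟨l, hl, hmax⟩ := exists_max_image (s \ M) f hne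
    have hl' := mem_sdiff.1 hl
    have hc : #(insert l M) = m + 1 := by
      rw [card_insert_of_notMem hl'.2, hor.resolve_left hM]
    refine ⟨insert l M, insert_subset hl'.1 hMs, hc.le, Or.inr hc, fun j hj l₂ hl₂ => ?_⟩
    have hl₂' : l₂ ∈ s \ M := sdiff_subset_sdiff subset_rfl (subset_insert l M) hl₂
    rcases mem_insert.1 hj with rfl | hj
    · exact hmax l₂ hl₂'
    · exact htop j hj l₂ hl₂'

end SparseSet

section Counting

variable [Fintype ι]

/-- The couplings of `i` to the variables outside `T`. -/
noncomputable def outer (J : ι → ι → ℝ) (T : Finset ι) (i j : ι) : ℝ := if j ∈ T then 0 else J i j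

/-- The variables outside `T` leave the spin at `i` undetermined. -/
def Free (h : ι → ℝ) (J : ι → ι → ℝ) (T : Finset ι) (i : ι) (S : ι → Bool) : Prop :=
  |field (h i) (outer J T i) S| < ∑ j ∈ T, |J i j|

theorem abs_spin (b : Bool) : |spin b| = 1 := by cases b <;> simp [spin]

theorem field_outer_congr (h : ι → ℝ) (J : ι → ι → ℝ) (T : Finset ι) (i : ι) {S S' : ι → Bool}
    (hS : ∀ j ∉ T, J i j ≠ 0 → S j = S' j) :
    field (h i) (outer J T i) S = field (h i) (outer J T i) S' := by
  unfold field
  congr 1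
  refine sum_congr rfl fun j _ => ?_
  by_cases hj : j ∈ T
  · simp [outer, hj]
  · by_cases h0 : J i j = 0
    · simp [outer, h0]
    · rw [hS j hj h0]

theorem eq_decide_of_not_free {h : ι → ℝ} {J : ι → ι → ℝ} {T : Finset ι} {i : ι} {S : ι → Bool}
    (hS : spin (S i) * field (h i) (J i) S < 0) (hf : ¬ Free h J T i S) :
    S i = decide (field (h i) (outer J T i) S < 0) := by
  have hsplit : field (h i) (J i) S =
      field (h i) (outer J T i) S + ∑ j ∈ T, J i j * spin (S j) := by
    have : ∑ j ∈ T, J i j * spin (S j) = ∑ j, if j ∈ T then J i j * spin (S j) else 0 := by simp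
    rw [this, field, field, add_assoc, ← sum_add_distrib]
    congr 1
    refine sum_congr rfl fun j _ => ?_
    by_cases hj : j ∈ T <;> simp [outer, hj]
  have hbound : |∑ j ∈ T, J i j * spin (S j)| ≤ ∑ j ∈ T, |J i j| :=
    (abs_sum_le_sum_abs _ _).trans (by simp [abs_mul, abs_spin])
  unfold Free at hf
  rw [not_lt] at hf
  have hle := abs_le.1 (hbound.trans hf)
  rw [hsplit] at hS
  cases hs : S i
  · rw [show spin (S i) = -1 by simp [hs, spin]] at hS
    refine (decide_eq_false fun hneg => ?_).symm
    rw [abs_of_neg hneg] at hle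
    linarith [hle.2]
  · rw [show spin (S i) = 1 by simp [hs, spin]] at hS
    refine (decide_eq_true ?_).symm
    by_contra! hnn
    rw [abs_of_nonneg hnn] at hle
    linarith [hle.1]

open Classical in
theorem card_mul_two_pow_le_sum_free {h : ι → ℝ} {J : ι → ι → ℝ} (T : Finset ι)
    (B : Finset (ι → Bool)) (hB : ∀ S ∈ B, ∀ i, spin (S i) * field (h i) (J i) S < 0) :
    #B * 2 ^ #T ≤ ∑ S : ι → Bool, 2 ^ #{i ∈ T | Free h J T i S} := by
  rw [card_mul_two_pow_eq_sum]
  refine sum_le_sum fun S' _ => ?_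
  let V : ι → Finset Bool := fun i =>
    if i ∈ T then
      if Free h J T i S' then univ else {decide (field (h i) (outer J T i) S' < 0)}
    else {S' i}
  have hsub : ({S ∈ B | ∀ j ∉ T, S j = S' j} : Finset (ι → Bool)) ⊆ Fintype.piFinset V := by
    intro S hS
    rw [mem_filter] at hS
    rw [Fintype.mem_piFinset]
    intro i
    have hcongr := field_outer_congr h J T i fun j hj _ => hS.2 j hj
    by_cases hi : i ∈ T
    · by_cases hf : Free h J T i S'
      · simp [V, hi, hf]
      · have hf' : ¬ Free h J T i S := by unfold Free at hf ⊢; rwa [hcongr]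
        have := eq_decide_of_not_free (hB S hS.1 i) hf'
        rw [hcongr] at this
        simp only [V, hi, hf, if_true, if_false, mem_singleton, this]
    · simp [V, hi, hS.2 i hi]
  refine (card_le_card hsub).trans (le_of_eq ?_)
  rw [Fintype.card_piFinset]
  have hcard : ∀ i, #(V i) = if i ∈ ({i ∈ T | Free h J T i S'} : Finset ι) then 2 else 1 := by
    intro i
    by_cases hi : i ∈ T <;> by_cases hf : Free h J T i S' <;> simp [V, hi, hf]
  rw [prod_congr rfl fun i _ => hcard i, prod_ite_mem, univ_inter, prod_const]

open Classical in
theorem card_mul_two_pow_le {h : ι → ℝ} {J : ι → ι → ℝ} (T : Finset ι) {k : ℕ} (hk : 0 < k)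
    (B : Finset (ι → Bool)) (hB : ∀ S ∈ B, ∀ i, spin (S i) * field (h i) (J i) S < 0)
    (hT : ∀ j, #{i ∈ T | J i j ≠ 0} ≤ k)
    (hfree : ∀ i ∈ T, #{S | Free h J T i S} * 2 ^ k ≤ 2 ^ Fintype.card ι) :
    (#B : ℝ) * 2 ^ #T ≤ 2 ^ Fintype.card ι * (2 : ℝ) ^ (#T / k : ℝ) := by
  have hk' : (k : ℝ) ≠ 0 := by positivity
  let F : ι → (ι → Bool) → ℝ := fun i S => if Free h J T i S then 2 ^ k else 1
  have hroot : ∀ i S, F i S ^ (1 / k : ℝ) = if Free h J T i S then 2 else 1 := by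
    intro i S
    by_cases hf : Free h J T i S
    · simp only [F, hf, if_true]
      rw [← Real.rpow_natCast, ← Real.rpow_mul two_pos.le, mul_one_div_cancel hk', Real.rpow_one]
    · simp [F, hf]
  have hmean : ∀ i ∈ T, 𝔼 S, F i S ≤ 2 := by
    intro i hi
    rw [Fintype.expect_eq_sum_div_card, div_le_iff₀ (by simp)]
    have h1 : ∑ S, F i S ≤ ∑ S, (1 + if Free h J T i S then (2 : ℝ) ^ k else 0) := by
      refine sum_le_sum fun S _ => ?_
      by_cases hf : Free h J T i S <;> simp [F, hf]
    have h2 : (#{S | Free h J T i S} * 2 ^ k : ℝ) ≤ 2 ^ Fintype.card ι := by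
      exact_mod_cast hfree i hi
    refine h1.trans ?_
    rw [sum_add_distrib, ← sum_filter, sum_const, sum_const, nsmul_eq_mul, nsmul_eq_mul]
    simp only [card_univ, Fintype.card_fun, Fintype.card_bool, Nat.cast_pow, Nat.cast_ofNat]
    linarith
  have hfin := expect_prod_rpow_le T hk univ F (fun i => {j | J i j ≠ 0})
    (fun i S => by dsimp only [F]; split_ifs <;> positivity)
    (fun i S S' hSS' => by
      have := field_outer_congr h J T i (S := S) (S' := S') fun j _ hj => hSS' j (by simpa using hj)
      have hiff : Free h J T i S ↔ Free h J T i S' := by rw [Free, this, Free]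
      simp only [F, hiff])
    (fun i => subset_univ _) (fun v => by simpa using hT v)
  have hcount : (#B : ℝ) * 2 ^ #T ≤ ∑ S, ∏ i ∈ T, F i S ^ (1 / k : ℝ) := by
    have h1 := card_mul_two_pow_le_sum_free T B hB
    have h2 : ((#B * 2 ^ #T : ℕ) : ℝ) ≤ (∑ S : ι → Bool, 2 ^ #{i ∈ T | Free h J T i S} : ℕ) := by
      exact_mod_cast h1
    push_cast at h2
    refine h2.trans (le_of_eq (sum_congr rfl fun S _ => ?_))
    rw [prod_congr rfl fun i _ => hroot i S, ← prod_filter, prod_const]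
  refine hcount.trans ?_
  rw [← Fintype.card_mul_expect]
  simp only [Fintype.card_fun, Fintype.card_bool, Nat.cast_pow, Nat.cast_ofNat]
  refine mul_le_mul_of_nonneg_left (hfin.trans ?_) (by positivity)
  calc ∏ i ∈ T, (𝔼 S, F i S) ^ (1 / k : ℝ) ≤ ∏ _i ∈ T, (2 : ℝ) ^ (1 / k : ℝ) := by
        have hnn : ∀ i, 0 ≤ 𝔼 S, F i S := fun i =>
          expect_nonneg fun S _ => by dsimp only [F]; split_ifs <;> positivity
        refine prod_le_prod (fun i _ => Real.rpow_nonneg (hnn i) _) fun i hi => ?_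
        exact Real.rpow_le_rpow (hnn i) (hmean i hi) (by positivity)
    _ = (2 : ℝ) ^ (#T / k : ℝ) := by
        rw [prod_const, ← Real.rpow_natCast, ← Real.rpow_mul two_pos.le]
        congr 1
        ring

open Classical in
theorem card_free_mul_le {h : ι → ℝ} {J : ι → ι → ℝ} {T M : Finset ι} {k : ℕ} (hk : 0 < k) {i : ι}
    (hTk : #{j ∈ T | J i j ≠ 0} ≤ k) (hMT : ∀ j ∈ M, j ∉ T)
    (hM : M = ({j | J i j ≠ 0} : Finset ι) ∨ #M = 16 ^ k)
    (htop : ∀ j ∈ M, ∀ l ∈ ({j | J i j ≠ 0} : Finset ι) \ M, |J i l| ≤ |J i j|) :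
    #{S | Free h J T i S} * 2 ^ k ≤ 2 ^ Fintype.card ι := by
  set X : Finset ι := {j ∈ T | J i j ≠ 0} with hX
  have hR : ∑ j ∈ T, |J i j| = ∑ j ∈ X, |J i j| := by
    rw [hX, sum_filter]
    refine sum_congr rfl fun j _ => ?_
    by_cases h0 : J i j = 0 <;> simp [h0]
  rcases X.eq_empty_or_nonempty with hXe | hXn
  · have : ({S | Free h J T i S} : Finset (ι → Bool)) = ∅ := by
      refine filter_eq_empty_iff.2 fun S _ hf => ?_
      rw [Free, hR, hXe, sum_empty] at hf
      exact (abs_nonneg _).not_gt hf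
    simp [this]
  obtain ⟨l, hl, hmax⟩ := exists_max_image X (fun j => |J i j|) hXn
  have hl' := mem_filter.1 hl
  have hlM : l ∉ M := fun h => hMT l h hl'.1
  have hcard : #M = 16 ^ k := hM.resolve_left fun h => hlM (h ▸ by simpa using hl'.2)
  have hRle : ∑ j ∈ T, |J i j| ≤ k * |J i l| := by
    rw [hR]
    refine (sum_le_card_nsmul X _ _ hmax).trans ?_
    rw [nsmul_eq_mul]
    gcongr
  have hLO := card_field_lt_mul_le (M := M) (c := h i) (w := outer J T i) (abs_pos.2 hl'.2)
    (fun j hj => by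
      rw [outer, if_neg (hMT j hj)]
      exact htop j hj l (by simp [hl'.2, hlM])) k
  have hsub : #{S | Free h J T i S} ≤ #{S | |field (h i) (outer J T i) S| < k * |J i l|} :=
    card_le_card fun S hS => by
      simp only [mem_filter, mem_univ, true_and] at hS ⊢
      exact lt_of_lt_of_le hS hRle
  rw [hcard] at hLO
  refine Nat.le_of_mul_le_mul_right (c := 2 ^ 16 ^ k) ?_ (by positivity)
  calc #{S | Free h J T i S} * 2 ^ k * 2 ^ 16 ^ k
      ≤ #{S | |field (h i) (outer J T i) S| < k * |J i l|} * 2 ^ k * 2 ^ 16 ^ k := by gcongr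
    _ = #{S | |field (h i) (outer J T i) S| < k * |J i l|} * 2 ^ 16 ^ k * 2 ^ k := by ring
    _ ≤ 2 ^ Fintype.card ι * (k * (16 ^ k).choose (16 ^ k / 2)) * 2 ^ k := by gcongr
    _ = 2 ^ Fintype.card ι * (k * (16 ^ k).choose (16 ^ k / 2) * 2 ^ k) := by ring
    _ ≤ 2 ^ Fintype.card ι * 2 ^ 16 ^ k := by
        gcongr
        exact mul_choose_half_mul_le k hk

end Counting

section LocalMin

theorem two_mul_energy {N : ℕ} (h : Fin N → ℝ) {J : Fin N → Fin N → ℝ}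
    (hsymm : ∀ i j, J i j = J j i) (hdiag : ∀ i, J i i = 0) (S : Fin N → ℝ) :
    2 * energy h J S = 2 * ∑ i, h i * S i + ∑ i, ∑ j, J i j * S i * S j := by
  have hswap : ∑ i, ∑ j, (if i < j then J i j * S i * S j else 0) =
      ∑ i, ∑ j, if j < i then J i j * S i * S j else 0 := by
    rw [sum_comm]
    refine sum_congr rfl fun i _ => sum_congr rfl fun j _ => ?_
    rw [hsymm j i]
    split_ifs <;> ring
  have hsum : ∑ i, ∑ j, J i j * S i * S j =
      ∑ i, ∑ j, (if i < j then J i j * S i * S j else 0) +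
        ∑ i, ∑ j, if j < i then J i j * S i * S j else 0 := by
    simp only [← sum_add_distrib]
    refine sum_congr rfl fun i _ => sum_congr rfl fun j _ => ?_
    rcases lt_trichotomy i j with hij | rfl | hij
    · simp [hij, hij.not_gt]
    · simp [hdiag]
    · simp [hij, hij.not_gt]
  rw [energy, hsum, ← hswap]
  ring

theorem energy_flipAt {N : ℕ} (h : Fin N → ℝ) {J : Fin N → Fin N → ℝ}
    (hsymm : ∀ i j, J i j = J j i) (hdiag : ∀ i, J i i = 0) (S : Fin N → ℝ) (i : Fin N) :
    energy h J (flipAt S i) = energy h J S - 2 * (S i * (h i + ∑ j, J i j * S j)) := by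
  have hflip : ∀ a, flipAt S i a = S a + if a = i then -2 * S i else 0 := by
    intro a
    by_cases ha : a = i
    · subst ha
      simp only [flipAt, Function.update_self, if_true]
      ring
    · simp [flipAt, ha]
  have h1 := two_mul_energy h hsymm hdiag S
  have h2 := two_mul_energy h hsymm hdiag (flipAt S i)
  have hlin : ∑ a, h a * flipAt S i a = ∑ a, h a * S a + h i * (-2 * S i) := by
    simp [hflip, mul_add, sum_add_distrib]
  have hcol : ∑ a, J a i * S a = ∑ a, J i a * S a := sum_congr rfl fun a _ => by rw [hsymm a i]
  have hquad : ∑ a, ∑ b, J a b * flipAt S i a * flipAt S i b =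
      ∑ a, ∑ b, J a b * S a * S b + 2 * ((-2 * S i) * ∑ j, J i j * S j) := by
    have hexp : ∀ a b, J a b * flipAt S i a * flipAt S i b = J a b * S a * S b +
        (if b = i then J a b * S a * (-2 * S i) else 0) +
        (if a = i then J a b * (-2 * S i) * S b else 0) +
        (if a = i then if b = i then J a b * (-2 * S i) * (-2 * S i) else 0 else 0) := by
      intro a b
      rw [hflip a, hflip b]
      split_ifs <;> ring
    simp only [hexp, sum_add_distrib, sum_ite_eq', mem_univ, if_true]
    have hs1 : ∑ a, J a i * S a * (-2 * S i) = (-2 * S i) * ∑ j, J i j * S j := by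
      rw [← hcol, mul_sum]
      exact sum_congr rfl fun a _ => by ring
    have hs2 : ∑ a, ∑ b, (if a = i then J a b * (-2 * S i) * S b else 0) =
        (-2 * S i) * ∑ j, J i j * S j := by
      rw [sum_comm, mul_sum]
      simp only [sum_ite_eq', mem_univ, if_true]
      exact sum_congr rfl fun a _ => by ring
    have hs3 : ∑ a, (∑ b, if a = i then
        if b = i then J a b * (-2 * S i) * (-2 * S i) else 0 else 0) = 0 := by
      rw [sum_comm]
      simp [hdiag]
    rw [hs1, hs2, hs3]
    ring
  rw [hlin, hquad] at h2
  linarith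

theorem exists_spin_eq {N : ℕ} {S : Fin N → ℝ} (hS : IsAssignment S) :
    ∃ b : Fin N → Bool, S = fun i => spin (b i) := by
  refine ⟨fun i => decide (S i = 1), funext fun i => ?_⟩
  rcases hS i with hi | hi <;> norm_num [hi, spin]

theorem exists_finset_localMin {N : ℕ} (h : Fin N → ℝ) {J : Fin N → Fin N → ℝ}
    (hsymm : ∀ i j, J i j = J j i) (hdiag : ∀ i, J i i = 0) :
    ∃ B : Finset (Fin N → Bool), Set.ncard {S : Fin N → ℝ | IsingLocalMin h J S} ≤ #B ∧
      ∀ S ∈ B, ∀ i, spin (S i) * field (h i) (J i) S < 0 := by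
  classical
  refine ⟨univ.filter fun b : Fin N → Bool => IsingLocalMin h J fun i => spin (b i), ?_, fun b hb i => ?_⟩
  · refine (Set.ncard_le_ncard (t := (fun (b : Fin N → Bool) i => spin (b i)) ''
      (univ.filter fun b : Fin N → Bool => IsingLocalMin h J fun i => spin (b i) : Finset _)) ?_
      (Set.toFinite _)).trans ?_
    · intro S hS
      obtain ⟨b, rfl⟩ := exists_spin_eq hS.1
      exact ⟨b, by simpa using hS, rfl⟩
    · exact (Set.ncard_image_le (Set.toFinite _)).trans (Set.ncard_coe_finset _).le
  · have := (mem_filter.1 hb).2.2 i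
    rw [energy_flipAt h hsymm hdiag] at this
    rw [field]
    linarith

end LocalMin

section Parameters

theorem pow_le_three_pow_mul_factorial (k : ℕ) : (k : ℝ) ^ k ≤ 3 ^ k * k.factorial := by
  have h := Real.pow_div_factorial_le_exp (x := (k : ℝ)) (by positivity) k
  rw [div_le_iff₀ (by positivity)] at h
  refine h.trans ?_
  gcongr
  rw [← Real.exp_one_pow]
  gcongr
  exact Real.exp_one_lt_d9.le.trans (by norm_num)

/-- The density of the sparse set used for degree at most `256 ^ k`. -/
noncomputable def density (k : ℕ) : ℝ := k / (4096 * 256 ^ k)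

theorem pow_mul_density_le (k : ℕ) : ((16 ^ k : ℕ) : ℝ) * density k ≤ 1 / 4 := by
  have hk : (k : ℝ) ≤ 16 ^ k := by exact_mod_cast (Nat.lt_pow_self (by norm_num : 1 < 16)).le
  have h256 : (256 : ℝ) ^ k = 16 ^ k * 16 ^ k := by rw [← mul_pow]; norm_num
  rw [density, h256]
  push_cast
  rw [mul_div_assoc', div_le_iff₀ (by positivity)]
  nlinarith [pow_pos (by norm_num : (0 : ℝ) < 16) k]

theorem density_le_one (k : ℕ) : density k ≤ 1 := by
  have h1 : (k : ℝ) ≤ 256 ^ k := by exact_mod_cast (Nat.lt_pow_self (by norm_num : 1 < 256)).le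
  rw [density, div_le_one (by positivity)]
  linarith [pow_pos (by norm_num : (0 : ℝ) < 256) k]

theorem choose_mul_density_pow_le {k : ℕ} (hk : 0 < k) :
    ((256 ^ k : ℕ) : ℝ) * ((256 ^ k).choose k : ℕ) * density k ^ k ≤ 1 / 4 := by
  have hf : (0 : ℝ) < k.factorial := by positivity
  have hc : (((256 ^ k).choose k : ℕ) : ℝ) ≤ ((256 ^ k : ℕ) : ℝ) ^ k / k.factorial :=
    Nat.choose_le_pow_div k _
  have hd : density k ^ k * ((256 ^ k : ℕ) : ℝ) ^ k = k ^ k / 4096 ^ k := by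
    rw [← mul_pow, ← div_pow, density]
    congr 1
    push_cast
    field_simp
  have hd0 : 0 ≤ density k := by unfold density; positivity
  calc ((256 ^ k : ℕ) : ℝ) * ((256 ^ k).choose k : ℕ) * density k ^ k
      ≤ ((256 ^ k : ℕ) : ℝ) * (((256 ^ k : ℕ) : ℝ) ^ k / k.factorial) * density k ^ k := by
        gcongr
    _ = 256 ^ k / k.factorial * (density k ^ k * ((256 ^ k : ℕ) : ℝ) ^ k) := by push_cast; ring
    _ = 256 ^ k / k.factorial * (k ^ k / 4096 ^ k) := by rw [hd]
    _ ≤ 256 ^ k / k.factorial * (3 ^ k * k.factorial / 4096 ^ k) := by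
        gcongr
        exact pow_le_three_pow_mul_factorial k
    _ = (3 / 16) ^ k := by
        rw [show (3 / 16 : ℝ) = 256 * 3 / 4096 by norm_num, div_pow, mul_pow]
        field_simp
    _ ≤ (3 / 16) ^ 1 := pow_le_pow_of_le_one (by norm_num) (by norm_num) hk
    _ ≤ 1 / 4 := by norm_num

theorem logb_div_le_density {d k : ℕ} (hd : 256 < d) (hdk : d ≤ 256 ^ k) (hkd : 256 ^ k ≤ 256 * d) :
    1 / 2 ^ 25 * Real.logb 2 (1 / 256 * d) / d ≤ density k / 4 := by
  have hd0 : (0 : ℝ) < d := by exact_mod_cast (by omega : 0 < d)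
  have hdk' : (d : ℝ) ≤ 256 ^ k := by exact_mod_cast hdk
  have hkd' : (256 : ℝ) ^ k ≤ 256 * d := by exact_mod_cast hkd
  have hlog : Real.logb 2 (1 / 256 * d) ≤ 8 * k := by
    rw [Real.logb_le_iff_le_rpow one_lt_two (by positivity)]
    calc (1 / 256 * d : ℝ) ≤ 256 ^ k := by linarith
      _ = 2 ^ (8 * k : ℝ) := by
        rw [show (8 * k : ℝ) = ((8 * k : ℕ) : ℝ) by push_cast; ring, Real.rpow_natCast, pow_mul]
        norm_num
  calc 1 / 2 ^ 25 * Real.logb 2 (1 / 256 * d) / d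
      ≤ (1 / 2 ^ 25 * (8 * k) / d : ℝ) := by gcongr
    _ ≤ (1 / 2 ^ 25 * (8 * k) / (256 ^ k / 256) : ℝ) := by
        gcongr
        linarith
    _ = density k / 4 := by
        rw [density]
        field_simp
        ring

end Parameters

theorem ncard_localMin_le_two_pow {N : ℕ} (h : Fin N → ℝ) {J : Fin N → Fin N → ℝ}
    (hsymm : ∀ i j, J i j = J j i) (hdiag : ∀ i, J i i = 0) :
    (Set.ncard {S : Fin N → ℝ | IsingLocalMin h J S} : ℝ) ≤ 2 ^ N := by
  obtain ⟨B, hB, -⟩ := exists_finset_localMin h hsymm hdiag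
  have h2 : #B ≤ 2 ^ N := (card_le_univ B).trans (by simp)
  exact_mod_cast hB.trans h2

theorem ncard_localMin_le_of_degree_le {N : ℕ} (h : Fin N → ℝ) {J : Fin N → Fin N → ℝ}
    (hsymm : ∀ i j, J i j = J j i) (hdiag : ∀ i, J i i = 0) {k : ℕ} (hk : 2 ≤ k)
    (hdeg : ∀ i, degreeJ J i ≤ 256 ^ k) :
    (Set.ncard {S : Fin N → ℝ | IsingLocalMin h J S} : ℝ) ≤
      2 ^ (N * (1 - density k / 4) : ℝ) := by
  classical
  obtain ⟨B, hB, hloc⟩ := exists_finset_localMin h hsymm hdiag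
  let nb : Fin N → Finset (Fin N) := fun i => {j | J i j ≠ 0}
  have hnb : ∀ i, #(nb i) ≤ 256 ^ k := by
    intro i
    refine le_trans (le_of_eq ?_) (hdeg i)
    rw [degreeJ, ← Set.ncard_coe_finset]
    congr 1
    ext j
    simp only [nb, coe_filter, mem_univ, true_and, Set.mem_ofPred_eq]
    exact ⟨fun hj => ⟨by rintro rfl; exact hj (hdiag _), hj⟩, fun hj => hj.2⟩
  choose M hMnb hMcard hMor hMtop using fun i => exists_top_subset (nb i) (fun j => |J i j|) (16 ^ k)
  have hk0 : 0 < k := by omega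
  obtain ⟨T, hTnb, hTM, hTcard⟩ := exists_sparse_set nb M
    (fun i j hj => by simpa [nb, hsymm j i] using hj) hnb hMcard
    (fun i hi => by simpa [nb, hdiag] using hMnb i hi)
    (by unfold density; positivity) (density_le_one k) (pow_mul_density_le k)
    (choose_mul_density_pow_le hk0)
  have hcol : ∀ j, #{i ∈ T | J i j ≠ 0} ≤ k := by
    intro j
    simpa [nb, hsymm j] using hTnb j
  have hrow : ∀ i, #{j ∈ T | J i j ≠ 0} ≤ k := by
    intro i
    simpa [nb] using hTnb i
  have hmain := card_mul_two_pow_le T hk0 B hloc hcol fun i hi =>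
    card_free_mul_le hk0 (hrow i) (hTM i hi) (hMor i) (hMtop i)
  rw [Fintype.card_fin] at hmain hTcard
  have hB' : (Set.ncard {S : Fin N → ℝ | IsingLocalMin h J S} : ℝ) ≤ #B := by exact_mod_cast hB
  have hle : (#B : ℝ) ≤ 2 ^ (N + #T / k - #T : ℝ) := by
    rw [Real.rpow_sub two_pos, Real.rpow_add two_pos, Real.rpow_natCast, Real.rpow_natCast,
      le_div_iff₀ (by positivity)]
    exact hmain
  refine hB'.trans (hle.trans (Real.rpow_le_rpow_of_exponent_le one_le_two ?_))
  have hhalf : (#T / k : ℝ) ≤ #T / 2 := by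
    gcongr
    exact_mod_cast hk
  linarith

end IsingCount

/-- there are `κ, λ > 0` such that every Ising instance on `N` variables whose
graph has maximum degree at most `d` (`d ≥ 1`) has at most `2^{N(1 - κ·log₂(λd)/d)}`
local minima. -/
theorem stmt16 :
    ∃ κ lam : ℝ, 0 < κ ∧ 0 < lam ∧
      ∀ (d : ℕ), 1 ≤ d →
        ∀ (N : ℕ) (h : Fin N → ℝ) (J : Fin N → Fin N → ℝ),
          (∀ i j, J i j = J j i) → (∀ i, J i i = 0) →
          (∀ i, degreeJ J i ≤ d) →
          (Set.ncard {S : Fin N → ℝ | IsingLocalMin h J S} : ℝ) ≤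
            (2 : ℝ) ^ ((N : ℝ) * (1 - κ * Real.logb 2 (lam * d) / d)) := by
  refine ⟨1 / 2 ^ 25, 1 / 256, by norm_num, by norm_num, ?_⟩
  intro d hd N h J hsymm hdiag hdeg
  rcases le_or_gt d 256 with hsmall | hlarge
  · refine (IsingCount.ncard_localMin_le_two_pow h hsymm hdiag).trans ?_
    rw [← Real.rpow_natCast]
    refine Real.rpow_le_rpow_of_exponent_le one_le_two ?_
    have hd' : (d : ℝ) ≤ 256 := by exact_mod_cast hsmall
    have hlog : Real.logb 2 (1 / 256 * d) ≤ 0 :=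
      Real.logb_nonpos one_lt_two (by positivity) (by linarith)
    have hneg : 1 / 2 ^ 25 * Real.logb 2 (1 / 256 * d) / d ≤ 0 :=
      div_nonpos_of_nonpos_of_nonneg (mul_nonpos_of_nonneg_of_nonpos (by norm_num) hlog)
        (by positivity)
    exact le_mul_of_one_le_right (by positivity) (by linarith)
  · set k := Nat.clog 256 d with hkdef
    have hdk : d ≤ 256 ^ k := Nat.le_pow_clog (by norm_num) d
    have hlt : 256 ^ (k - 1) < d := Nat.pow_pred_clog_lt_self (by norm_num) (by omega)
    have hk : 2 ≤ k := by
      by_contra! hk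
      have : (256 : ℕ) ^ k ≤ 256 ^ 1 := Nat.pow_le_pow_right (by norm_num) (by omega)
      omega
    have hkd : 256 ^ k ≤ 256 * d := by
      obtain ⟨l, hl⟩ : ∃ l, k = l + 1 := ⟨k - 1, by omega⟩
      rw [hl, Nat.add_sub_cancel] at hlt
      rw [hl, pow_succ]
      omega
    refine (IsingCount.ncard_localMin_le_of_degree_le h hsymm hdiag hk
      fun i => (hdeg i).trans hdk).trans ?_
    refine Real.rpow_le_rpow_of_exponent_le one_le_two ?_
    have := IsingCount.logb_div_le_density hlarge hdk hkd
    gcongr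
end
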